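/- arXiv:math/0607329 — 5 statements merged into one kernel-verified Lean document; each statement's English description precedes it below -/
import Mathlib

section
/- Let G be a finite simple graph on vertices x_1,…,x_n with no isolated vertices whose complement G' is a chordal graph, and let J = I_c(G) be the ideal of vertex covers of G. Then the Rees algebra R[Jt] is normal; equivalently, with u_1,…,u_s the incidence vectors of the minimal vertex covers of G, ℕ{e_1,…,e_n,(u_1,1),…,(u_s,1)} = ℤ^{n+1} ∩ ℝ₊(J). -/
open Finset

/-- A vertex cover of a graph: a set of vertices meeting every edge. -/
def IsVCover {n : ℕ} (G : SimpleGraph (Fin n)) (C : Finset (Fin n)) : Prop :=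
  ∀ ⦃a b : Fin n⦄, G.Adj a b → a ∈ C ∨ b ∈ C

/-- A minimal vertex cover: no proper subset is a vertex cover. -/
def IsMinVCover {n : ℕ} (G : SimpleGraph (Fin n)) (C : Finset (Fin n)) : Prop :=
  IsVCover G C ∧ ∀ D : Finset (Fin n), D ⊂ C → ¬ IsVCover G D

/-- The clique number of a graph: maximal size of a clique. -/
noncomputable def cliqueNumber {V : Type*} (G : SimpleGraph V) : ℕ :=
  sSup { k : ℕ | ∃ t : Finset V, G.IsNClique k t }

/-- A graph is perfect if for every induced subgraph the chromatic number
equals the clique number. -/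
def IsPerfect {V : Type*} (G : SimpleGraph V) : Prop :=
  ∀ s : Set V, (G.induce s).chromaticNumber = (cliqueNumber (G.induce s) : ℕ∞)

/-- The Rees cone of the ideal of vertex covers `I_c(G)`: all non-negative real
combinations of the unit vectors `e_1,…,e_n` and the vectors `(u_C, 1)` where
`u_C` runs over incidence vectors of minimal vertex covers of `G`. Vectors of
`ℝ^{n+1}` are represented as pairs `(a, a_{n+1}) : (Fin n → ℝ) × ℝ`. -/
def reesCone {n : ℕ} (G : SimpleGraph (Fin n)) : Set ((Fin n → ℝ) × ℝ) :=
  { v | ∃ (c : Fin n → ℝ) (d : Finset (Fin n) → ℝ),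
      (∀ i, 0 ≤ c i) ∧ (∀ C, 0 ≤ d C) ∧
      (∀ C, d C ≠ 0 → IsMinVCover G C) ∧
      (∀ i, v.1 i = c i + ∑ C : Finset (Fin n), d C * (if i ∈ C then 1 else 0)) ∧
      v.2 = ∑ C : Finset (Fin n), d C }


/-- A graph is chordal if every cycle of length at least 4 has a chord, i.e.
an edge of the graph joining two non-adjacent (non-consecutive) vertices of
the cycle. -/
def IsChordal {V : Type*} (G : SimpleGraph V) : Prop :=
  ∀ ⦃v : V⦄ (c : G.Walk v v), c.IsCycle → 4 ≤ c.length →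
    ∃ u w : V, u ∈ c.support ∧ w ∈ c.support ∧ G.Adj u w ∧ s(u, w) ∉ c.edges

/-- `z ∈ ℕA'`: the integral vector `z ∈ ℤ^{n+1}` is a non-negative integer
combination of `A' = {e_1,…,e_n, (u_1,1),…,(u_s,1)}`, where `u_1,…,u_s` are
the incidence vectors of the minimal vertex covers of `G`. -/
def IsNNCombA' {n : ℕ} (G : SimpleGraph (Fin n)) (z : (Fin n → ℤ) × ℤ) : Prop :=
  ∃ (c : Fin n → ℕ) (d : Finset (Fin n) → ℕ),
    (∀ C, d C ≠ 0 → IsMinVCover G C) ∧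
    (∀ i, z.1 i = (c i : ℤ) + ∑ C : Finset (Fin n), (d C : ℤ) * (if i ∈ C then 1 else 0)) ∧
    z.2 = ∑ C : Finset (Fin n), (d C : ℤ)

namespace SimpleGraph

variable {V : Type*} {H : SimpleGraph V}

/-- A chord between two vertices of a walk yields a strictly shorter walk inside its support. -/
lemma Walk.exists_shorter_of_chord {x y u w : V} (p : H.Walk x y) (hu : u ∈ p.support)
    (hw : w ∈ p.support) (huw : H.Adj u w) (hne : s(u, w) ∉ p.edges) :
    ∃ q : H.Walk x y, q.support ⊆ p.support ∧ q.length < p.length := by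
  have key : ∀ {u w : V} (q : H.Walk x u) (r : H.Walk u w) (s : H.Walk w y), H.Adj u w →
      p = q.append (r.append s) → s(u, w) ∉ p.edges →
      ∃ q : H.Walk x y, q.support ⊆ p.support ∧ q.length < p.length := by
    rintro u w q r s huw rfl hne
    refine ⟨q.append (cons huw s), ?_, ?_⟩
    · intro v
      simp only [mem_support_append_iff, support_cons, List.mem_cons]
      rintro (h | rfl | h)
      · exact .inl h
      · exact .inl q.end_mem_support
      · exact .inr (.inr h)
    · cases r with
      | nil => exact absurd huw (H.loopless.irrefl _)
      | cons h r =>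
        cases r with
        | nil => simp at hne
        | cons h' r => simp only [length_append, length_cons]; omega
  obtain ⟨q, r, rfl⟩ := mem_support_iff_exists_append.1 hu
  rcases (mem_support_append_iff _ _).1 hw with h | h
  · obtain ⟨q₁, q₂, rfl⟩ := mem_support_iff_exists_append.1 h
    exact key q₁ q₂ r huw.symm (append_assoc _ _ _).symm (by rwa [Sym2.eq_swap])
  · obtain ⟨r₁, r₂, rfl⟩ := mem_support_iff_exists_append.1 h
    exact key q r₁ r₂ huw rfl hne

/-- If `x` and `y` are joined both by a walk inside a set `S` and by a vertex `t` outside `S` whose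
only neighbours in `S` are among `x` and `y`, then `x` and `y` are adjacent in a chordal graph. -/
lemma adj_of_isChordal (hH : IsChordal H) {S : Set V} {x y t : V} (hxy : x ≠ y)
    (htx : H.Adj t x) (hty : H.Adj t y) (htS : t ∉ S)
    (hS : ∀ v ∈ S, H.Adj t v → v = x ∨ v = y)
    (hp : ∃ p : H.Walk x y, ∀ v ∈ p.support, v ∈ S) : H.Adj x y := by
  classical
  by_contra hnadj
  obtain ⟨p, hpS, hmin⟩ : ∃ p : H.Walk x y, (∀ v ∈ p.support, v ∈ S) ∧
      ∀ q : H.Walk x y, (∀ v ∈ q.support, v ∈ S) → p.length ≤ q.length := by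
    obtain ⟨p, hp, h⟩ := exists_minimalFor_of_wellFoundedLT
      (fun p : H.Walk x y => ∀ v ∈ p.support, v ∈ S) Walk.length hp
    exact ⟨p, hp, fun q hq => (le_total p.length q.length).elim id (h hq)⟩
  have hpath : p.IsPath := by
    rw [← p.bypass_eq_self_of_length_le_length_bypass
      (hmin _ fun v hv => hpS v (p.support_bypass_subset_support hv))]
    exact p.bypass_isPath
  have htp : t ∉ p.support := fun h => htS (hpS t h)
  have hlen : 2 ≤ p.length := by
    cases p with
    | nil => exact absurd rfl hxy
    | cons h p =>
      cases p with
      | nil => exact absurd h hnadj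
      | cons h' p => simp only [Walk.length_cons]; omega
  have hcyc : (Walk.cons htx (p.concat hty.symm)).IsCycle := by
    rw [Walk.cons_isCycle_iff, Walk.concat_isPath_iff, Walk.edges_concat]
    refine ⟨⟨hpath, htp⟩, ?_⟩
    rw [List.concat_eq_append, List.mem_append, List.mem_singleton]
    rintro (h | h)
    · exact htp (p.fst_mem_support_of_mem_edges h)
    · rw [Sym2.eq_swap (a := y), Sym2.congr_right] at h
      exact hxy h
  obtain ⟨u, w, hu, hw, huw, hne⟩ := hH _ hcyc (by
    simp only [Walk.length_cons, Walk.length_concat]; omega)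
  simp only [Walk.support_cons, Walk.support_concat, List.mem_cons, List.mem_append,
    List.not_mem_nil, or_false] at hu hw
  simp only [Walk.edges_cons, Walk.edges_concat, List.concat_eq_append, List.mem_cons,
    List.mem_append, List.not_mem_nil, or_false, not_or] at hne
  obtain ⟨hne₁, hne₂, hne₃⟩ := hne
  have hchord : ∀ v ∈ p.support, H.Adj t v → s(t, v) = s(t, x) ∨ s(t, v) = s(y, t) := by
    intro v hv htv
    rcases hS v (hpS v hv) htv with rfl | rfl
    · exact .inl rfl
    · exact .inr Sym2.eq_swap
  have hu' : u = t ∨ u ∈ p.support := by tauto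
  have hw' : w = t ∨ w ∈ p.support := by tauto
  rcases hu' with rfl | hu'
  · rcases hw' with rfl | hw'
    · exact H.loopless.irrefl _ huw
    · rcases hchord w hw' huw with h | h
      exacts [hne₁ h, hne₃ h]
  · rcases hw' with rfl | hw'
    · rw [Sym2.eq_swap] at hne₁ hne₃
      rcases hchord u hu' huw.symm with h | h
      exacts [hne₁ h, hne₃ h]
    · obtain ⟨q, hq, hlt⟩ := p.exists_shorter_of_chord hu' hw' huw hne₂
      exact absurd (hmin q fun v hv => hpS v (hq hv)) (by omega)

/-- Dirac's theorem: every nonempty induced subgraph of a chordal graph has a simplicial vertex. -/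
theorem exists_simplicial_of_isChordal (hH : IsChordal H) (A : Finset V) (hA : A.Nonempty) :
    ∃ v ∈ A, H.IsClique {u | u ∈ A ∧ (u = v ∨ H.Adj v u)} := by
  classical
  induction A using Finset.strongInduction with
  | H A ih =>
  by_cases hcl : H.IsClique (A : Set V)
  · obtain ⟨v, hv⟩ := hA
    exact ⟨v, hv, hcl.subset fun u hu => hu.1⟩
  -- a maximal connected set `S` that does not dominate `A`
  let P : Finset V → Prop := fun S =>
    S.Nonempty ∧ (∀ a ∈ S, ∀ b ∈ S, ∃ p : H.Walk a b, ∀ v ∈ p.support, v ∈ S) ∧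
      ∃ t ∈ A, t ∉ S ∧ ∀ s ∈ S, ¬ H.Adj s t
  obtain ⟨S, hSA, hSmax⟩ : ∃ S, (S ⊆ A ∧ P S) ∧ ∀ S' ⊆ A, P S' → S ⊆ S' → S' ⊆ S := by
    obtain ⟨a, ha, b, hb, hab, hnadj⟩ : ∃ a ∈ A, ∃ b ∈ A, a ≠ b ∧ ¬ H.Adj a b := by
      simpa [IsClique, Set.Pairwise] using hcl
    have hne : {S ∈ A.powerset | P S}.Nonempty := by
      refine ⟨{a}, mem_filter.2 ⟨mem_powerset.2 (by simpa using ha), ⟨a, by simp⟩, ?_, b, hb, ?_⟩⟩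
      · simp only [mem_singleton]
        rintro _ rfl _ rfl
        exact ⟨Walk.nil, by simp⟩
      · simpa using ⟨hab.symm, hnadj⟩
    obtain ⟨S, hS, hmax⟩ := exists_maximal hne
    rw [mem_filter, mem_powerset] at hS
    exact ⟨S, hS, fun S' h₁ h₂ h₃ => hmax (mem_filter.2 ⟨mem_powerset.2 h₁, h₂⟩) h₃⟩
  obtain ⟨hSA, hSne, hconn, t, htA, htS, ht⟩ := hSA
  set T := {t ∈ A | t ∉ S ∧ ∀ s ∈ S, ¬ H.Adj s t} with hT
  set N := {x ∈ A | x ∉ S ∧ ∃ s ∈ S, H.Adj s x} with hN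
  have hNT : ∀ x ∈ N, ∀ t ∈ T, H.Adj x t := by
    intro x hx t ht
    obtain ⟨hxA, hxS, s, hs, hsx⟩ := mem_filter.1 hx
    obtain ⟨htA, htS, hts⟩ := mem_filter.1 ht
    by_contra hxt
    refine hxS (hSmax (insert x S) (insert_subset hxA hSA) ⟨⟨x, by simp⟩, ?_, t, htA, ?_, ?_⟩
      (subset_insert _ _) (mem_insert_self _ _))
    · have hstart : ∀ b ∈ S, ∃ p : H.Walk x b, ∀ v ∈ p.support, v ∈ insert x S := by
        intro b hb
        obtain ⟨p, hp⟩ := hconn s hs b hb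
        refine ⟨Walk.cons hsx.symm p, ?_⟩
        simp only [Walk.support_cons, List.mem_cons, mem_insert]
        exact fun v hv => hv.imp id (hp v)
      intro a ha b hb
      rcases mem_insert.1 ha with rfl | ha' <;> rcases mem_insert.1 hb with rfl | hb'
      · exact ⟨Walk.nil, by simp⟩
      · exact hstart b hb'
      · obtain ⟨p, hp⟩ := hstart a ha'
        exact ⟨p.reverse, by simpa using hp⟩
      · obtain ⟨p, hp⟩ := hconn a ha' b hb'
        exact ⟨p, fun v hv => mem_insert_of_mem (hp v hv)⟩
    · rw [mem_insert, not_or]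
      refine ⟨?_, htS⟩
      rintro rfl
      exact hts s hs hsx
    · intro a ha
      rcases mem_insert.1 ha with rfl | ha
      exacts [hxt, hts a ha]
  have hNcl : ∀ x ∈ N, ∀ y ∈ N, x ≠ y → H.Adj x y := by
    intro x hx y hy hxy
    have htT : t ∈ T := mem_filter.2 ⟨htA, htS, ht⟩
    have htx := (hNT x hx t htT).symm
    have hty := (hNT y hy t htT).symm
    obtain ⟨-, -, s, hs, hsx⟩ := mem_filter.1 hx
    obtain ⟨-, -, s', hs', hsy⟩ := mem_filter.1 hy
    obtain ⟨p, hp⟩ := hconn s hs s' hs'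
    refine adj_of_isChordal hH (S := {v | v = x ∨ v = y ∨ v ∈ S}) hxy htx hty ?_ ?_
      ⟨Walk.cons hsx.symm (p.concat hsy), ?_⟩
    · rintro (rfl | rfl | h)
      exacts [H.loopless.irrefl _ htx, H.loopless.irrefl _ hty, htS h]
    · rintro v (h | h | h) htv
      exacts [.inl h, .inr h, absurd htv.symm (ht v h)]
    · simp only [Walk.support_cons, Walk.support_concat, List.mem_cons, List.mem_append,
        List.not_mem_nil, or_false, Set.mem_ofPred_eq]
      rintro v (h | h | h)
      exacts [.inl h, .inr (.inr (hp v h)), .inr (.inl h)]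
  have hTA : T ⊂ A := by
    obtain ⟨s, hs⟩ := hSne
    exact (ssubset_iff_of_subset (filter_subset _ _)).2
      ⟨s, hSA hs, fun h => (mem_filter.1 h).2.1 hs⟩
  obtain ⟨v, hvT, hv⟩ := ih T hTA ⟨t, mem_filter.2 ⟨htA, htS, ht⟩⟩
  obtain ⟨hvA, hvS, hvs⟩ := mem_filter.1 hvT
  have hsplit : ∀ u ∈ A, u = v ∨ H.Adj v u → u ∈ N ∨ (u ∈ T ∧ (u = v ∨ H.Adj v u)) := by
    intro u hu huv
    have huS : u ∉ S := by
      rintro h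
      rcases huv with rfl | huv
      exacts [hvS h, hvs u h huv.symm]
    by_cases h : ∃ s ∈ S, H.Adj s u
    · exact .inl (mem_filter.2 ⟨hu, huS, h⟩)
    · push Not at h
      exact .inr ⟨mem_filter.2 ⟨hu, huS, h⟩, huv⟩
  refine ⟨v, hvA, ?_⟩
  rintro a ⟨haA, ha⟩ b ⟨hbA, hb⟩ hab
  rcases hsplit a haA ha with ha | ha <;> rcases hsplit b hbA hb with hb | hb
  · exact hNcl a ha b hb hab
  · exact hNT a ha b hb.1
  · exact (hNT b hb a ha.1).symm
  · exact hv ha hb hab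

/-- In a chordal graph, every vertex weighting admits a clique cover whose size is at most the
weight of some independent set contained in the support of the weighting. -/
theorem exists_clique_cover_of_isChordal [Fintype V] [DecidableEq V] (hH : IsChordal H)
    (w : V → ℕ) :
    ∃ (S : Finset V) (M : Multiset (Finset V)),
      (∀ a ∈ S, ∀ b ∈ S, ¬ H.Adj a b) ∧ (∀ i ∈ S, w i ≠ 0) ∧
      (∀ K ∈ M, H.IsClique (K : Set V)) ∧ (∀ i, w i ≤ M.countP (i ∈ ·)) ∧
      M.card ≤ ∑ i ∈ S, w i := by
  classical
  induction hA : ({i | w i ≠ 0} : Finset V) using Finset.strongInduction generalizing w with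
  | H A ih =>
  have hmemA : ∀ i, i ∈ A ↔ w i ≠ 0 := fun i => by simp [← hA]
  rcases A.eq_empty_or_nonempty with hAe | hAne
  · refine ⟨∅, 0, by simp, by simp, by simp, fun i => ?_, by simp⟩
    have : ¬ w i ≠ 0 := by simp [← hmemA, hAe]
    omega
  obtain ⟨v, hvA, hv⟩ := exists_simplicial_of_isChordal hH A hAne
  set K : Finset V := {u ∈ A | u = v ∨ H.Adj v u} with hK
  have hvK : v ∈ K := by simp [hK, hvA]
  have hKcl : H.IsClique (K : Set V) := by simpa [hK] using hv
  let w' : V → ℕ := fun i => if i ∈ K then w i - w v else w i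
  have hw'K : ∀ i ∈ K, w' i = w i - w v := fun i hi => if_pos hi
  have hw'N : ∀ i ∉ K, w' i = w i := fun i hi => if_neg hi
  have hw'le : ∀ i, w' i ≤ w i := fun i => by
    by_cases h : i ∈ K
    · rw [hw'K i h]; omega
    · rw [hw'N i h]
  have hss : ({i | w' i ≠ 0} : Finset V) ⊂ A := by
    refine (ssubset_iff_of_subset fun i hi => ?_).2 ⟨v, hvA, ?_⟩
    · rw [hmemA]
      have := hw'le i
      have : w' i ≠ 0 := by simpa using hi
      omega
    · simp [hw'K v hvK]
  obtain ⟨S, M, hS, hSw, hM, hcov, hcard⟩ := ih _ hss w' rfl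
  have hSA : ∀ i ∈ S, i ∈ A := fun i hi => by
    rw [hmemA]
    have := hw'le i
    have := hSw i hi
    omega
  have hcov' : ∀ i, w i ≤ (M + Multiset.replicate (w v) K).countP (i ∈ ·) := by
    intro i
    have := hcov i
    rw [Multiset.countP_add, ← Multiset.coe_replicate, Multiset.coe_countP, List.countP_replicate]
    by_cases h : i ∈ K
    · rw [hw'K i h] at this
      simp only [h, decide_true, if_true]
      omega
    · rw [hw'N i h] at this
      omega
  have hM' : ∀ L ∈ M + Multiset.replicate (w v) K, H.IsClique (L : Set V) := by
    intro L hL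
    rcases Multiset.mem_add.1 hL with h | h
    · exact hM L h
    · rw [Multiset.eq_of_mem_replicate h]; exact hKcl
  have hcard' : (M + Multiset.replicate (w v) K).card ≤ ∑ i ∈ S, w' i + w v := by
    rw [Multiset.card_add, Multiset.card_replicate]
    omega
  by_cases hSK : ∃ u ∈ S, u ∈ K
  · obtain ⟨u, huS, huK⟩ := hSK
    refine ⟨S, _, hS, fun i hi => (hmemA i).1 (hSA i hi), hM', hcov', hcard'.trans ?_⟩
    rw [← add_sum_erase _ _ huS, ← add_sum_erase _ w huS]
    have h₁ := hSw u huS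
    have h₂ := hw'K u huK
    have h₃ : ∑ i ∈ S.erase u, w' i ≤ ∑ i ∈ S.erase u, w i := sum_le_sum fun i _ => hw'le i
    omega
  · push Not at hSK
    have hvS : v ∉ S := fun h => hSK v h hvK
    have hnadj : ∀ u ∈ S, ¬ H.Adj v u := fun u hu h =>
      hSK u hu (mem_filter.2 ⟨hSA u hu, .inr h⟩)
    refine ⟨insert v S, _, ?_, ?_, hM', hcov', hcard'.trans ?_⟩
    · intro a ha b hb
      rcases mem_insert.1 ha with rfl | ha' <;> rcases mem_insert.1 hb with rfl | hb'
      · exact H.loopless.irrefl _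
      · exact hnadj b hb'
      · exact fun h => hnadj a ha' h.symm
      · exact hS a ha' b hb'
    · intro i hi
      rw [← hmemA]
      rcases mem_insert.1 hi with rfl | hi
      exacts [hvA, hSA i hi]
    · rw [sum_insert hvS, add_comm]
      exact Nat.add_le_add_left (sum_le_sum fun i _ => hw'le i) _

end SimpleGraph

/-- The complement of a clique of the complement graph contains a minimal vertex cover. -/
lemma exists_isMinVCover_disjoint {n : ℕ} (G : SimpleGraph (Fin n)) (K : Finset (Fin n))
    (hK : Gᶜ.IsClique (K : Set (Fin n))) : ∃ C, IsMinVCover G C ∧ ∀ i ∈ K, i ∉ C := by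
  classical
  have hcov : IsVCover G Kᶜ := by
    intro a b hab
    by_contra! h
    simp only [mem_compl, not_not] at h
    exact ((SimpleGraph.compl_adj _ _ _).1 (hK h.1 h.2 hab.ne)).2 hab
  obtain ⟨C, hle, hC⟩ := Set.Finite.exists_le_minimal (s := {C | IsVCover G C})
    (Set.toFinite _) hcov
  exact ⟨C, ⟨hC.prop, fun D hD h => hD.not_subset (hC.le_of_le h hD.subset)⟩,
    fun i hi hiC => mem_compl.1 (hle hiC) hi⟩

/-- A clique of `G` has total deficiency at most `b` with respect to a point of height `b` of the
Rees cone. -/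
lemma sum_sub_le_of_mem_reesCone {n : ℕ} {G : SimpleGraph (Fin n)} {v : (Fin n → ℝ) × ℝ}
    (hv : v ∈ reesCone G) {S : Finset (Fin n)} (hS : G.IsClique (S : Set (Fin n))) :
    ∑ i ∈ S, (v.2 - v.1 i) ≤ v.2 := by
  obtain ⟨c, d, hc, hd, hmin, h₁, h₂⟩ := hv
  calc ∑ i ∈ S, (v.2 - v.1 i)
      ≤ ∑ i ∈ S, ∑ C : Finset (Fin n), d C * (if i ∈ C then 0 else 1) := by
        refine sum_le_sum fun i _ => ?_
        have : ∑ C : Finset (Fin n), d C * (if i ∈ C then 0 else 1)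
            = v.2 - ∑ C : Finset (Fin n), d C * (if i ∈ C then 1 else 0) := by
          rw [h₂, ← sum_sub_distrib]
          refine sum_congr rfl fun C _ => ?_
          split_ifs <;> ring
        rw [this, h₁ i]
        linarith [hc i]
    _ = ∑ C : Finset (Fin n), d C * ∑ i ∈ S, (if i ∈ C then 0 else 1) := by
        rw [sum_comm]
        exact sum_congr rfl fun C _ => (mul_sum _ _ _).symm
    _ ≤ ∑ C : Finset (Fin n), d C := by
        refine sum_le_sum fun C _ => ?_
        by_cases hdC : d C = 0
        · simp [hdC]
        have hcard : #{i ∈ S | i ∉ C} ≤ 1 := by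
          refine card_le_one.2 fun a ha b hb => ?_
          rw [mem_filter] at ha hb
          by_contra hab
          rcases (hmin C hdC).1 (hS ha.1 hb.1 hab) with h | h
          exacts [ha.2 h, hb.2 h]
        have hsum : ∑ i ∈ S, (if i ∈ C then (0 : ℝ) else 1) = #{i ∈ S | i ∉ C} := by
          rw [card_filter]
          push_cast
          exact sum_congr rfl fun i _ => by split_ifs <;> simp_all
        rw [hsum]
        exact mul_le_of_le_one_right (hd C) (by exact_mod_cast hcard)
    _ = v.2 := h₂.symm

/-- Counting the members of a multiset that satisfy a predicate as a weighted sum. -/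
lemma Multiset.sum_count_mul_ite {α : Type*} [Fintype α] [DecidableEq α] (M : Multiset α)
    (p : α → Prop) [DecidablePred p] :
    ∑ a, (M.count a : ℤ) * (if p a then 1 else 0) = M.countP p := by
  induction M using Multiset.induction_on with
  | empty => simp
  | cons a M ih =>
    simp only [Multiset.count_cons, Multiset.countP_cons, Nat.cast_add, add_mul, sum_add_distrib,
      ih, Nat.cast_ite, Nat.cast_one, Nat.cast_zero, ite_mul, one_mul, zero_mul]
    rw [sum_ite_eq' univ a]
    simp

/-- A multiset of minimal vertex covers, each vertex `i` lying in at most `z.1 i` of them, exhibits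
`z` as an integral combination of the generators. -/
lemma isNNCombA'_of_multiset {n : ℕ} {G : SimpleGraph (Fin n)} {z : (Fin n → ℤ) × ℤ}
    (M : Multiset (Finset (Fin n))) (hM : ∀ C ∈ M, IsMinVCover G C)
    (hle : ∀ i, (M.countP (i ∈ ·) : ℤ) ≤ z.1 i) (hcard : (M.card : ℤ) = z.2) :
    IsNNCombA' G z := by
  refine ⟨fun i => (z.1 i - M.countP (i ∈ ·)).toNat, fun C => M.count C, ?_, ?_, ?_⟩
  · exact fun C hC => hM C (Multiset.count_ne_zero.1 hC)
  · intro i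
    have := hle i
    rw [Multiset.sum_count_mul_ite, Int.toNat_of_nonneg (by omega)]
    omega
  · rw [← hcard]
    have := M.sum_count_mul_ite fun _ => True
    simpa using this.symm

/-- Let `G` be a graph on `x_1,…,x_n` with no isolated
vertices whose complement `G'` is chordal, and let `J = I_c(G)`. Then the
Rees algebra `R[Jt]` is normal; equivalently,
`ℕ{e_1,…,e_n,(u_1,1),…,(u_s,1)} = ℤ^{n+1} ∩ ℝ₊(J)`, where `u_1,…,u_s` are the
incidence vectors of the minimal vertex covers of `G`. -/
theorem rees_normal_of_compl_chordal {n : ℕ} (G : SimpleGraph (Fin n))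
    (hiso : ∀ v : Fin n, ∃ w : Fin n, G.Adj v w)
    (hchordal : IsChordal Gᶜ) :
    ∀ z : (Fin n → ℤ) × ℤ,
      ((fun i => (z.1 i : ℝ)), (z.2 : ℝ)) ∈ reesCone G ↔ IsNNCombA' G z := by
  rintro ⟨a, b⟩
  constructor
  · intro hz
    have hb : 0 ≤ b := by
      obtain ⟨c, d, -, hd, -, -, h₂⟩ := hz
      have : (0 : ℝ) ≤ b := (sum_nonneg fun C _ => hd C).trans_eq h₂.symm
      exact_mod_cast this
    obtain ⟨S, M, hS, hSw, hM, hcov, hcard⟩ :=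
      SimpleGraph.exists_clique_cover_of_isChordal hchordal fun i => (b - a i).toNat
    have hScl : G.IsClique (S : Set (Fin n)) := fun x hx y hy hxy => by
      by_contra h
      exact hS x hx y hy ((SimpleGraph.compl_adj _ _ _).2 ⟨hxy, h⟩)
    have hcard_le : (M.card : ℤ) ≤ b := by
      have h₁ : ∑ i ∈ S, (b - a i) ≤ b := by
        have := sum_sub_le_of_mem_reesCone hz hScl
        simp only at this
        exact_mod_cast this
      have h₂ : ((∑ i ∈ S, (b - a i).toNat : ℕ) : ℤ) = ∑ i ∈ S, (b - a i) := by
        push_cast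
        refine sum_congr rfl fun i hi => ?_
        have := hSw i hi
        omega
      omega
    have hN : ∀ K : Finset (Fin n), K ∈ M + Multiset.replicate (b.toNat - M.card) ∅ →
        Gᶜ.IsClique (K : Set (Fin n)) := by
      intro K hK
      rcases Multiset.mem_add.1 hK with h | h
      · exact hM K h
      · rw [Multiset.eq_of_mem_replicate h]; simp
    have hNcard : ((M + Multiset.replicate (b.toNat - M.card) ∅).card : ℤ) = b := by
      rw [Multiset.card_add, Multiset.card_replicate]
      omega
    have hNcov : ∀ i, (b - a i).toNat ≤
        (M + Multiset.replicate (b.toNat - M.card) ∅).countP (i ∈ ·) := fun i =>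
      (hcov i).trans (by rw [Multiset.countP_add]; omega)
    generalize M + Multiset.replicate (b.toNat - M.card) ∅ = N at hN hNcard hNcov
    have hex : ∀ K : Finset (Fin n), ∃ C, Gᶜ.IsClique (K : Set (Fin n)) →
        IsMinVCover G C ∧ ∀ i ∈ K, i ∉ C := fun K => by
      by_cases hK : Gᶜ.IsClique (K : Set (Fin n))
      · obtain ⟨C, hC⟩ := exists_isMinVCover_disjoint G K hK
        exact ⟨C, fun _ => hC⟩
      · exact ⟨∅, fun h => absurd h hK⟩
    choose f hf using hex
    refine isNNCombA'_of_multiset (N.map f) ?_ ?_ (by rwa [Multiset.card_map])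
    · intro C hC
      obtain ⟨K, hK, rfl⟩ := Multiset.mem_map.1 hC
      exact (hf K (hN K hK)).1
    · intro i
      have hle : (N.map f).countP (i ∈ ·) ≤ N.countP (fun K => ¬ i ∈ K) := by
        rw [Multiset.countP_map, Multiset.countP_eq_card_filter]
        refine Multiset.card_le_card (Multiset.le_filter.2 ⟨Multiset.filter_le _ _, ?_⟩)
        intro K hK hiK
        rw [Multiset.mem_filter] at hK
        exact (hf K (hN K hK.1)).2 i hiK hK.2
      have hsum := N.card_eq_countP_add_countP (i ∈ ·)
      have := hNcov i
      simp only
      omega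
  · rintro ⟨c, d, hd, h₁, h₂⟩
    refine ⟨fun i => c i, fun C => d C, fun i => by positivity, fun C => by positivity,
      fun C hC => hd C (by simpa using hC), fun i => ?_, ?_⟩
    · simp only at h₁ ⊢
      rw [h₁ i]
      push_cast
      rfl
    · simp only at h₂ ⊢
      rw [h₂]
      push_cast
      rfl
end

section
/- Let A be a balanced {0,1}-matrix of size n×q with column vectors v_1,…,v_q, and set w_i = 𝟙 − v_i for i = 1,…,q (𝟙 the all-ones vector of ℝ^n). Then the Rees algebra of the ideal I* = (x^{w_1},…,x^{w_q}) ⊂ K[x_1,…,x_n] is a normal domain; equivalently, ℕ{e_1,…,e_n,(w_1,1),…,(w_q,1)} = ℤ^{n+1} ∩ ℝ₊{e_1,…,e_n,(w_1,1),…,(w_q,1)}. -/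
open Finset

/-- A `{0,1}`-matrix (with entries in `ℕ`, all at most `1`) is balanced if it
has no square submatrix of odd order with exactly two `1`'s in each row and
each column. -/
def IsBalanced {n q : ℕ} (A : Matrix (Fin n) (Fin q) ℕ) : Prop :=
  ¬ ∃ (k : ℕ) (r : Fin k → Fin n) (c : Fin k → Fin q),
      Odd k ∧ Function.Injective r ∧ Function.Injective c ∧
      (∀ i : Fin k, ∑ j : Fin k, A (r i) (c j) = 2) ∧
      (∀ j : Fin k, ∑ i : Fin k, A (r i) (c j) = 2)

namespace SimpleGraph

variable {V : Type*} {G : SimpleGraph V}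

/-- A closed walk of minimal odd length visits no vertex twice. -/
theorem Walk.getVert_ne_of_minimal_odd {u : V} (p : G.Walk u u) (hodd : Odd p.length)
    (hmin : ∀ (v : V) (w : G.Walk v v), Odd w.length → p.length ≤ w.length)
    {a b : ℕ} (hab : a < b) (hb : b < p.length) : p.getVert a ≠ p.getVert b := by
  intro h
  have h1 : ∃ w : G.Walk (p.getVert a) (p.getVert a), w.length = b - a := by
    have hv : (p.drop a).getVert (b - a) = p.getVert a := by
      rw [Walk.drop_getVert, h]; congr 1; omega
    refine ⟨((p.drop a).take (b - a)).copy rfl hv, ?_⟩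
    simp only [Walk.length_copy, Walk.take_length, Walk.drop_length]
    omega
  have h2 : ∃ w : G.Walk u u, w.length = p.length - (b - a) := by
    refine ⟨((p.take a).copy rfl h).append (p.drop b), ?_⟩
    simp only [Walk.length_append, Walk.length_copy, Walk.take_length, Walk.drop_length]
    omega
  obtain ⟨w1, hw1⟩ := h1
  obtain ⟨w2, hw2⟩ := h2
  rcases Nat.even_or_odd (b - a) with he | ho
  · have := hmin _ w2 (by rw [hw2]; exact Nat.Odd.sub_even (by omega) hodd he)
    omega
  · have := hmin _ w1 (by rw [hw1]; exact ho)
    omega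

/-- A graph that is not 2-colorable contains an odd cycle, here given as a cyclically indexed
injective sequence of vertices. -/
theorem exists_odd_cycle_of_not_colorable_two (h : ¬ G.Colorable 2) :
    ∃ (k : ℕ) (r : Fin (k + 1) → V), Odd (k + 1) ∧ 2 ≤ k ∧ Function.Injective r ∧
      ∀ i, G.Adj (r i) (r (i + 1)) := by
  classical
  rw [two_colorable_iff_forall_loop_even] at h
  push Not at h
  have hex : ∃ l : ℕ, ∃ (u : V) (w : G.Walk u u), Odd w.length ∧ w.length = l := by
    obtain ⟨u, w, hw⟩ := h
    exact ⟨_, u, w, by simpa using hw, rfl⟩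
  obtain ⟨u, p, hodd, hlen⟩ := Nat.find_spec hex
  have hmin : ∀ (v : V) (w : G.Walk v v), Odd w.length → p.length ≤ w.length := by
    intro v w hw
    rw [hlen]
    exact Nat.find_min' hex ⟨v, w, hw, rfl⟩
  have hne : p.length ≠ 1 := by
    intro h1
    have := p.adj_getVert_succ (i := 0) (by omega)
    rw [zero_add, ← h1, p.getVert_length, p.getVert_zero] at this
    exact G.irrefl this
  obtain ⟨m, hm⟩ := hodd
  refine ⟨p.length - 1, fun i => p.getVert i, ⟨m, by omega⟩, by omega, ?_, ?_⟩
  · intro i j hij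
    by_contra hne'
    rcases lt_or_gt_of_ne (fun h' => hne' (Fin.ext h')) with hlt | hlt
    · exact p.getVert_ne_of_minimal_odd ⟨m, hm⟩ hmin hlt (by omega) hij
    · exact p.getVert_ne_of_minimal_odd ⟨m, hm⟩ hmin hlt (by omega) hij.symm
  · intro i
    have hadj := p.adj_getVert_succ (i := i) (by omega)
    beta_reduce
    rw [Fin.val_add_one]
    split_ifs with hl
    · have hi : (i : ℕ) + 1 = p.length := by
        rw [hl, Fin.val_last]; omega
      rw [hi, p.getVert_length] at hadj
      rw [p.getVert_zero]
      exact hadj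
    · exact hadj

/-- Every nonempty finite graph has a vertex `v` whose neighbours stay mutually reachable
when `v` is removed. -/
theorem exists_vertex_neighbors_reachable [Finite V] (t : V) :
    ∃ v, G.Reachable t v ∧ ∀ (P : V → Prop),
      (∀ a b, a ≠ v → b ≠ v → G.Adj a b → (P a ↔ P b)) →
      ∀ a b, G.Adj v a → G.Adj v b → (P a ↔ P b) := by
  let C := G.connectedComponentMk t
  obtain ⟨⟨v, hv⟩, hpre⟩ :=
    C.connected_toSimpleGraph.exists_preconnected_induce_compl_singleton_of_finite
  refine ⟨v, (ConnectedComponent.exact hv).symm, ?_⟩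
  intro P hP a b ha hb
  have haC : a ∈ C := C.mem_supp_of_adj_mem_supp hv ha
  have hbC : b ∈ C := C.mem_supp_of_adj_mem_supp hv hb
  obtain ⟨w⟩ := hpre ⟨⟨a, haC⟩, fun h => ha.ne (congrArg Subtype.val h).symm⟩
    ⟨⟨b, hbC⟩, fun h => hb.ne (congrArg Subtype.val h).symm⟩
  have key : ∀ x y, (C.toSimpleGraph.induce {⟨v, hv⟩}ᶜ).Walk x y → (P x.1.1 ↔ P y.1.1) := by
    intro x y w
    induction w with
    | nil => rfl
    | @cons x y z hxy _ ih =>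
      refine (hP _ _ (fun h => x.2 (Subtype.ext h)) (fun h => y.2 (Subtype.ext h)) ?_).trans ih
      exact hxy
  exact key _ _ w

end SimpleGraph

section Balanced

variable {n q : ℕ} {A : Matrix (Fin n) (Fin q) ℕ}

/-- The graph on the rows in `T` whose edges are the columns of `A` that have exactly two `1`'s
in the rows of `T`. -/
def pairGraph (A : Matrix (Fin n) (Fin q) ℕ) (T : Finset (Fin n)) : SimpleGraph (Fin n) where
  Adj u w := u ≠ w ∧ u ∈ T ∧ w ∈ T ∧ ∃ j, ∀ x ∈ T, A x j = 1 ↔ x = u ∨ x = w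
  symm := ⟨fun _ _ ⟨h, hu, hw, j, hj⟩ =>
    ⟨h.symm, hw, hu, j, fun x hx => (hj x hx).trans or_comm⟩⟩
  loopless := ⟨fun _ h => h.1 rfl⟩

theorem pairGraph_colorable_two (h01 : ∀ i j, A i j ≤ 1) (hbal : IsBalanced A)
    (T : Finset (Fin n)) : (pairGraph A T).Colorable 2 := by
  by_contra hcol
  obtain ⟨k, r, hodd, hk, hr, hadj⟩ := SimpleGraph.exists_odd_cycle_of_not_colorable_two hcol
  choose hne hT _ c hc using hadj
  have hval : ∀ i j, A (r i) (c j) = (if i = j then 1 else 0) + (if i = j + 1 then 1 else 0) := by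
    intro i j
    have h := hc j (r i) (hT i)
    rw [hr.eq_iff, hr.eq_iff] at h
    have hjj : j ≠ j + 1 := fun h' => hne j (congrArg r h')
    have hle := h01 (r i) (c j)
    split_ifs with h1 h2 h2
    · exact absurd (h1.symm.trans h2) hjj
    · simpa using h.2 (Or.inl h1)
    · simpa using h.2 (Or.inr h2)
    · have : A (r i) (c j) ≠ 1 := fun h' => (h.1 h').elim h1 h2
      omega
  have htwo : (1 : Fin (k + 1)) + 1 ≠ 0 := by
    intro h
    have h' := congrArg Fin.val h
    have h1 : ((1 : Fin (k + 1)) : ℕ) = 1 := by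
      rw [Fin.val_one']; exact Nat.mod_eq_of_lt (by omega)
    rw [Fin.val_add, h1, Fin.val_zero, Nat.mod_eq_of_lt (by omega)] at h'
    omega
  refine hbal ⟨k + 1, r, c, hodd, hr, ?_, ?_, ?_⟩
  · intro j j' hjj
    have h1 := (hc j' (r j) (hT j)).1 (hjj ▸ (hc j (r j) (hT j)).2 (Or.inl rfl))
    have h2 := (hc j (r j') (hT j')).1 (hjj ▸ (hc j' (r j') (hT j')).2 (Or.inl rfl))
    rw [hr.eq_iff, hr.eq_iff] at h1 h2
    rcases h1 with h1 | h1
    · exact h1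
    rcases h2 with h2 | h2
    · exact h2.symm
    · rw [h2, add_assoc] at h1
      exact absurd (left_eq_add.1 h1) htwo
  · intro i
    simp only [hval, Finset.sum_add_distrib, ← sub_eq_iff_eq_add]
    simp
  · intro j
    simp [hval, Finset.sum_add_distrib]

/-- Berge's theorem: the rows of a balanced matrix can be bicolored so that every column with
at least two `1`'s sees both colors, and the same holds for every subset of the rows. -/
theorem IsBalanced.exists_bicoloring (h01 : ∀ i j, A i j ≤ 1) (hbal : IsBalanced A)
    (T : Finset (Fin n)) :
    ∃ f : Fin n → Bool, ∀ j, ∀ u ∈ T, ∀ w ∈ T, u ≠ w → A u j = 1 → A w j = 1 →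
      ∃ a ∈ T, ∃ b ∈ T, A a j = 1 ∧ A b j = 1 ∧ f a = true ∧ f b = false := by
  classical
  induction T using Finset.strongInduction with
  | H T ih =>
  rcases T.eq_empty_or_nonempty with rfl | ⟨t, ht⟩
  · exact ⟨fun _ => true, by simp⟩
  obtain ⟨v, htv, hv⟩ := (pairGraph A T).exists_vertex_neighbors_reachable t
  have hvT : v ∈ T := by
    obtain ⟨p⟩ := htv.symm
    cases p with
    | nil => exact ht
    | cons h _ => exact h.2.1
  obtain ⟨f, hf⟩ := ih (T.erase v) (Finset.erase_ssubset hvT)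
  obtain ⟨g⟩ := pairGraph_colorable_two h01 hbal T
  have hnbr : ∀ a b, (pairGraph A T).Adj v a → (pairGraph A T).Adj v b → f a = f b := by
    intro a b ha hb
    have key := hv (fun x => (f x = true ↔ g x = 0)) ?_ a b ha hb
    · have h1 := g.valid ha
      have h2 := g.valid hb
      have h3 : g a = g b := by omega
      rw [h3] at key
      by_cases h0 : g b = 0 <;> simpa [h0] using key
    · intro x y hx hy hxy
      have hg := g.valid hxy
      obtain ⟨hne, hxT, hyT, j, hj⟩ := hxy
      obtain ⟨s, hs, s', hs', hsj, hsj', hfs, hfs'⟩ := hf j x (Finset.mem_erase.2 ⟨hx, hxT⟩) y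
        (Finset.mem_erase.2 ⟨hy, hyT⟩) hne ((hj x hxT).2 (Or.inl rfl)) ((hj y hyT).2 (Or.inr rfl))
      have e1 := (hj s (Finset.mem_of_mem_erase hs)).1 hsj
      have e2 := (hj s' (Finset.mem_of_mem_erase hs')).1 hsj'
      have hfne : f x = !f y := by
        rcases e1 with e1 | e1 <;> rcases e2 with e2 | e2 <;> rw [e1] at hfs <;>
          rw [e2] at hfs' <;> first | simp [hfs, hfs']; done | simp [hfs] at hfs'
      have hg0 : g x = 0 ↔ ¬ g y = 0 := by omega
      rw [hg0, hfne]
      cases f y <;> simp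
  have hcolor : ∃ col : Bool, ∀ a, (pairGraph A T).Adj v a → f a = !col := by
    by_cases hex : ∃ a, (pairGraph A T).Adj v a
    · obtain ⟨a, ha⟩ := hex
      exact ⟨!f a, fun b hb => by rw [Bool.not_not]; exact hnbr b a hb ha⟩
    · exact ⟨true, fun a ha => absurd ⟨a, ha⟩ hex⟩
  obtain ⟨col, hcol⟩ := hcolor
  refine ⟨Function.update f v col, ?_⟩
  intro j u hu w hw huw huj hwj
  by_cases htwo : ∃ x ∈ T.erase v, ∃ y ∈ T.erase v, x ≠ y ∧ A x j = 1 ∧ A y j = 1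
  · obtain ⟨x, hx, y, hy, hxy, hxj, hyj⟩ := htwo
    obtain ⟨s, hs, s', hs', hsj, hsj', hfs, hfs'⟩ := hf j x hx y hy hxy hxj hyj
    rw [Finset.mem_erase] at hs hs'
    exact ⟨s, hs.2, s', hs'.2, hsj, hsj', by simp [hs.1, hfs], by simp [hs'.1, hfs']⟩
  · have hpair : ∃ x ∈ T, x ≠ v ∧ A v j = 1 ∧ A x j = 1 := by
      by_cases h1 : u = v
      · exact ⟨w, hw, fun h => huw (h1.trans h.symm), h1 ▸ huj, hwj⟩
      · by_cases h2 : w = v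
        · exact ⟨u, hu, h1, h2 ▸ hwj, huj⟩
        · exact absurd ⟨u, Finset.mem_erase.2 ⟨h1, hu⟩, w, Finset.mem_erase.2 ⟨h2, hw⟩,
            huw, huj, hwj⟩ htwo
    obtain ⟨x, hxT, hxv, hvj, hxj⟩ := hpair
    have hadj : (pairGraph A T).Adj v x := by
      refine ⟨hxv.symm, hvT, hxT, j, fun y hy => ⟨fun hyj => ?_, ?_⟩⟩
      · by_contra hcon
        rw [not_or] at hcon
        exact htwo ⟨x, Finset.mem_erase.2 ⟨hxv, hxT⟩, y, Finset.mem_erase.2 ⟨hcon.1, hy⟩,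
          fun h => hcon.2 h.symm, hxj, hyj⟩
      · rintro (rfl | rfl) <;> assumption
    have hfx := hcol x hadj
    cases col
    · exact ⟨x, hxT, v, hvT, hxj, hvj, by simp [hxv, hfx], by simp⟩
    · exact ⟨v, hvT, x, hxT, hvj, hxj, by simp, by simp [hxv, hfx]⟩

/-- A multiset of rows of a balanced matrix splits in two parts such that every column that
meets it at least twice meets both parts. -/
theorem IsBalanced.exists_split (h01 : ∀ i j, A i j ≤ 1) (hbal : IsBalanced A)
    (u : Fin n → ℕ) :
    ∃ u₁ u₂ : Fin n → ℕ, (∀ i, u₁ i + u₂ i = u i) ∧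
      ∀ j, 2 ≤ ∑ i, u i * A i j → 1 ≤ ∑ i, u₁ i * A i j ∧ 1 ≤ ∑ i, u₂ i * A i j := by
  classical
  obtain ⟨f, hf⟩ := hbal.exists_bicoloring h01 (Finset.univ.filter fun i => u i = 1)
  let u₁ : Fin n → ℕ := fun i => if 2 ≤ u i then 1 else if f i = true then u i else 0
  have hle : ∀ i, u₁ i ≤ u i := by
    intro i
    simp only [u₁]
    split_ifs <;> omega
  have hpos : ∀ (y : Fin n → ℕ) j i, 1 ≤ y i → A i j = 1 → 1 ≤ ∑ i, y i * A i j := by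
    intro y j i hy hA
    calc 1 ≤ y i * A i j := by rw [hA]; omega
      _ ≤ _ := Finset.single_le_sum (f := fun i => y i * A i j) (fun _ _ => Nat.zero_le _)
        (Finset.mem_univ i)
  refine ⟨u₁, fun i => u i - u₁ i, fun i => Nat.add_sub_cancel' (hle i), ?_⟩
  intro j hj
  by_cases hbig : ∃ i, 2 ≤ u i ∧ A i j = 1
  · obtain ⟨i, hi, hA⟩ := hbig
    have h1 : u₁ i = 1 := by simp [u₁, hi]
    exact ⟨hpos _ j i (by omega) hA, hpos _ j i (show 1 ≤ u i - u₁ i by omega) hA⟩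
  · have hsmall : ∀ i, u i * A i j = if u i = 1 ∧ A i j = 1 then 1 else 0 := by
      intro i
      have h1 := h01 i j
      split_ifs with h
      · simp [h]
      · by_cases hA : A i j = 1
        · have : u i = 0 := by
            by_contra h0
            exact hbig ⟨i, by grind, hA⟩
          simp [this]
        · have : A i j = 0 := by omega
          simp [this]
    simp only [hsmall, Finset.sum_boole, Nat.cast_id] at hj
    obtain ⟨x, hx, y, hy, hxy⟩ := Finset.one_lt_card.1 (show 1 < _ from hj)
    simp only [Finset.mem_filter, Finset.mem_univ, true_and] at hx hy
    obtain ⟨a, ha, b, hb, haj, hbj, hfa, hfb⟩ := hf j x (by simp [hx]) y (by simp [hy]) hxy hx.2 hy.2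
    simp only [Finset.mem_filter, Finset.mem_univ, true_and] at ha hb
    exact ⟨hpos _ j a (by simp [u₁, ha, hfa]) haj, hpos _ j b (by simp [u₁, hb, hfb]) hbj⟩

/-- A multiset of rows of a balanced matrix that meets every column at most `N` times is the sum
of `N` multisets that meet every column at most once. -/
theorem IsBalanced.exists_decomposition (h01 : ∀ i j, A i j ≤ 1) (hbal : IsBalanced A)
    {N : ℕ} (hN : 0 < N) (y : Fin n → ℕ) (hy : ∀ j, ∑ i, y i * A i j ≤ N) :
    ∃ Y : Fin N → Fin n → ℕ, (∀ i, ∑ c, Y c i = y i) ∧ ∀ c j, ∑ i, Y c i * A i j ≤ 1 := by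
  classical
  let Φ : (Fin N → Fin n → ℕ) → ℕ := fun Y => ∑ j, ∑ c, min 1 (∑ i, Y c i * A i j)
  have hΦ : ∀ Y, Φ Y ≤ q * N := by
    intro Y
    calc Φ Y ≤ ∑ _j : Fin q, ∑ _c : Fin N, 1 :=
          Finset.sum_le_sum fun j _ => Finset.sum_le_sum fun c _ => min_le_left _ _
      _ = q * N := by simp
  have hex : ∃ m Y, (∀ i, ∑ c, Y c i = y i) ∧ q * N - Φ Y = m :=
    ⟨_, fun c i => if c = ⟨0, hN⟩ then y i else 0, by simp, rfl⟩
  obtain ⟨Y, hY, hYm⟩ := Nat.find_spec hex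
  have hmax : ∀ Y', (∀ i, ∑ c, Y' c i = y i) → Φ Y' ≤ Φ Y := by
    intro Y' hY'
    have h1 := Nat.find_min' hex ⟨Y', hY', rfl⟩
    have h2 := hΦ Y
    have h3 := hΦ Y'
    omega
  refine ⟨Y, hY, ?_⟩
  by_contra hcon
  push Not at hcon
  obtain ⟨p, j₀, hp⟩ := hcon
  have htot : ∀ j, ∑ c, ∑ i, Y c i * A i j = ∑ i, y i * A i j := by
    intro j
    rw [Finset.sum_comm]
    exact Finset.sum_congr rfl fun i _ => by rw [← Finset.sum_mul, hY]
  have hr : ∃ r, ∑ i, Y r i * A i j₀ = 0 := by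
    by_contra hno
    push Not at hno
    have : ∑ _c : Fin N, 1 < ∑ c, ∑ i, Y c i * A i j₀ :=
      Finset.sum_lt_sum (fun c _ => Nat.one_le_iff_ne_zero.2 (hno c)) ⟨p, Finset.mem_univ _, hp⟩
    have h2 := hy j₀
    rw [htot] at this
    simp at this
    omega
  obtain ⟨r, hr⟩ := hr
  have hpr : r ≠ p := by
    rintro rfl
    omega
  obtain ⟨u₁, u₂, hu, hsplit⟩ := hbal.exists_split h01 (fun i => Y p i + Y r i)
  let Y' : Fin N → Fin n → ℕ := Function.update (Function.update Y p u₁) r u₂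
  have hY'p : Y' p = u₁ := by simp [Y', hpr.symm]
  have hY'r : Y' r = u₂ := by simp [Y']
  have hrest : ∀ c ∈ (Finset.univ.erase r).erase p, Y' c = Y c := by
    intro c hc
    simp only [Finset.mem_erase, Finset.mem_univ, and_true] at hc
    simp [Y', hc.1, hc.2]
  have hdecomp : ∀ F : Fin N → ℕ,
      ∑ c, F c = F r + (F p + ∑ c ∈ (Finset.univ.erase r).erase p, F c) := by
    intro F
    rw [Finset.add_sum_erase _ _ (by simp [hpr.symm]), Finset.add_sum_erase _ _ (by simp)]
  have hY'sum : ∀ i, ∑ c, Y' c i = y i := by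
    intro i
    rw [← hY i, hdecomp, hdecomp (fun c => Y c i), hY'p, hY'r,
      Finset.sum_congr rfl fun c hc => congrFun (hrest c hc) i]
    have := hu i
    omega
  have hcol : ∀ j, (∑ i, u₁ i * A i j) + ∑ i, u₂ i * A i j =
      (∑ i, Y p i * A i j) + ∑ i, Y r i * A i j := by
    intro j
    simp only [← Finset.sum_add_distrib, ← add_mul, hu]
  have hcol' : ∀ j, ∑ i, (Y p i + Y r i) * A i j =
      (∑ i, Y p i * A i j) + ∑ i, Y r i * A i j := by
    intro j
    simp only [← Finset.sum_add_distrib, ← add_mul]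
  have hlt : Φ Y < Φ Y' := by
    have hterm : ∀ j, (∑ c, min 1 (∑ i, Y' c i * A i j)) + min 1 (∑ i, Y r i * A i j) +
        min 1 (∑ i, Y p i * A i j) = (∑ c, min 1 (∑ i, Y c i * A i j)) +
        min 1 (∑ i, u₁ i * A i j) + min 1 (∑ i, u₂ i * A i j) := by
      intro j
      rw [hdecomp, hdecomp (fun c => min 1 (∑ i, Y c i * A i j)), hY'p, hY'r,
        Finset.sum_congr (g := fun c => min 1 (∑ i, Y c i * A i j)) rfl
          fun c hc => by rw [hrest c hc]]
      ring
    refine Finset.sum_lt_sum (fun j _ => ?_) ⟨j₀, Finset.mem_univ _, ?_⟩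
    · have h1 := hterm j
      have h2 := hcol j
      have h3 := hsplit j
      rw [hcol'] at h3
      omega
    · have h1 := hterm j₀
      have h2 := hcol j₀
      have h3 := hsplit j₀
      rw [hcol'] at h3
      omega
  exact absurd (hmax Y' hY'sum) (not_le.2 hlt)

/-- If every multiset of rows that meets each column at most once has weight at most `b`, then
`b` columns, with repetition, suffice to cover each row `i` at least `d i` times. -/
theorem IsBalanced.exists_cover (h01 : ∀ i j, A i j ≤ 1) (hbal : IsBalanced A) (b : ℕ)
    (d : Fin n → ℕ)
    (hd : ∀ y : Fin n → ℕ, (∀ j, ∑ i, y i * A i j ≤ 1) → ∑ i, d i * y i ≤ b) :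
    ∃ η : Fin q → ℕ, ∑ j, η j ≤ b ∧ ∀ i, d i ≤ ∑ j, A i j * η j := by
  classical
  induction b generalizing d with
  | zero =>
    refine ⟨0, by simp, fun i => ?_⟩
    have h := hd (Pi.single i 1) (fun j => by simpa [Pi.single_apply] using h01 i j)
    simpa [Pi.single_apply] using h
  | succ b ih =>
    have hcol : (∀ y : Fin n → ℕ, (∀ j, ∑ i, y i * A i j ≤ 1) → ∑ i, d i * y i ≤ b) ∨
        ∃ k, ∀ y : Fin n → ℕ, (∀ j, ∑ i, y i * A i j ≤ 1) → (∀ i, d i = 0 → y i = 0) →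
          ∑ i, d i * y i = b + 1 → 1 ≤ ∑ i, y i * A i k := by
      by_contra hcon
      push Not at hcon
      obtain ⟨⟨s, hs, hsb⟩, hmiss⟩ := hcon
      choose S hS _ hSb hSk using hmiss
      let y : Fin n → ℕ := fun i => 2 * s i + ∑ k, S k i
      have hy : ∀ j, ∑ i, y i * A i j ≤ q + 1 := by
        intro j
        have e : ∑ i, y i * A i j = 2 * ∑ i, s i * A i j + ∑ k, ∑ i, S k i * A i j := by
          rw [Finset.sum_comm, Finset.mul_sum, ← Finset.sum_add_distrib]
          exact Finset.sum_congr rfl fun i _ => by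
            simp only [y]; rw [add_mul, Finset.sum_mul, mul_assoc]
        have h1 : ∑ k, ∑ i, S k i * A i j < ∑ _k : Fin q, 1 :=
          Finset.sum_lt_sum (fun k _ => hS k j) ⟨j, Finset.mem_univ _, hSk j⟩
        have h2 := hs j
        simp only [Finset.sum_const, Finset.card_univ, Fintype.card_fin, smul_eq_mul,
          mul_one] at h1
        omega
      obtain ⟨Y, hY, hYst⟩ := hbal.exists_decomposition h01 (Nat.succ_pos q) y hy
      have hle : ∑ i, d i * y i ≤ (q + 1) * (b + 1) := by
        calc ∑ i, d i * y i = ∑ c, ∑ i, d i * Y c i := by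
              rw [Finset.sum_comm]
              exact Finset.sum_congr rfl fun i _ => by rw [← Finset.mul_sum, hY]
          _ ≤ ∑ _c : Fin (q + 1), (b + 1) := Finset.sum_le_sum fun c _ => hd _ (hYst c)
          _ = _ := by simp
      have heq : ∑ i, d i * y i = 2 * ∑ i, d i * s i + q * (b + 1) := by
        calc ∑ i, d i * y i = 2 * ∑ i, d i * s i + ∑ k, ∑ i, d i * S k i := by
              rw [Finset.sum_comm, Finset.mul_sum, ← Finset.sum_add_distrib]
              exact Finset.sum_congr rfl fun i _ => by
                simp only [y]; rw [mul_add, Finset.mul_sum]; ring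
          _ = _ := by simp [hSb]
      rw [heq] at hle
      nlinarith
    rcases hcol with h | ⟨k, hk⟩
    · obtain ⟨η, h1, h2⟩ := ih d h
      exact ⟨η, by omega, h2⟩
    · have hred : ∀ y : Fin n → ℕ, (∀ j, ∑ i, y i * A i j ≤ 1) →
          ∑ i, (d i - A i k) * y i ≤ b := by
        intro y hy
        let y' : Fin n → ℕ := fun i => if d i = 0 then 0 else y i
        have hy' : ∀ j, ∑ i, y' i * A i j ≤ 1 := fun j =>
          (Finset.sum_le_sum fun i _ => Nat.mul_le_mul_right _ (by
            simp only [y']; split_ifs <;> omega)).trans (hy j)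
        have hsum : ∑ i, (d i - A i k) * y i + ∑ i, y' i * A i k = ∑ i, d i * y' i := by
          rw [← Finset.sum_add_distrib]
          refine Finset.sum_congr rfl fun i _ => ?_
          by_cases h0 : d i = 0
          · simp [y', h0]
          · have h1 := h01 i k
            simp only [y', h0, if_false]
            rw [mul_comm (y i), ← add_mul, Nat.sub_add_cancel (by omega)]
        have hle := hd y' hy'
        have hkk := hk y' hy' (fun i h0 => by simp [y', h0])
        omega
      obtain ⟨η, h1, h2⟩ := ih (fun i => d i - A i k) hred
      refine ⟨fun j => η j + if j = k then 1 else 0, ?_, fun i => ?_⟩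
      · simp only [Finset.sum_add_distrib, Finset.sum_ite_eq', Finset.mem_univ, if_true]
        omega
      · have := h2 i
        simp only [mul_add, Finset.sum_add_distrib, mul_ite, mul_one, mul_zero,
          Finset.sum_ite_eq', Finset.mem_univ, if_true]
        omega

end Balanced

/-- Let `A` be a balanced `{0,1}`-matrix of size `n × q`
with columns `v_1,…,v_q` and set `w_i = 𝟙 − v_i`. Then the Rees algebra of
the dual ideal `I* = (x^{w_1},…,x^{w_q})` is a normal domain; equivalently,
`ℕ{e_1,…,e_n,(w_1,1),…,(w_q,1)} = ℤ^{n+1} ∩ ℝ₊{e_1,…,e_n,(w_1,1),…,(w_q,1)}`: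
every integral vector of the cone of non-negative real combinations of
`{e_1,…,e_n,(w_1,1),…,(w_q,1)}` is a non-negative integer combination of
these vectors. -/
theorem rees_dual_normal_of_balanced {n q : ℕ} (A : Matrix (Fin n) (Fin q) ℕ)
    (h01 : ∀ i j, A i j ≤ 1) (hbal : IsBalanced A) :
    ∀ z : (Fin n → ℤ) × ℤ,
      (∃ (c : Fin n → ℝ) (η : Fin q → ℝ), (∀ i, 0 ≤ c i) ∧ (∀ j, 0 ≤ η j) ∧
        (∀ i, (z.1 i : ℝ) = c i + ∑ j, η j * (1 - (A i j : ℝ))) ∧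
        (z.2 : ℝ) = ∑ j, η j) ↔
      ∃ (c : Fin n → ℕ) (η : Fin q → ℕ),
        (∀ i, z.1 i = (c i : ℤ) + ∑ j, (η j : ℤ) * (1 - (A i j : ℤ))) ∧
        z.2 = ∑ j, (η j : ℤ) := by
  rintro ⟨a, b⟩
  constructor
  · rintro ⟨c, η, hc, hη, ha, hb⟩
    simp only at ha hb
    have hb0 : 0 ≤ b := by
      have : (0 : ℝ) ≤ b := hb ▸ Finset.sum_nonneg fun j _ => hη j
      exact_mod_cast this
    lift b to ℕ using hb0
    have hcov : ∀ i, ((b - a i : ℤ) : ℝ) ≤ ∑ j, (A i j : ℝ) * η j := by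
      intro i
      have h1 : ∑ j, η j * (1 - (A i j : ℝ)) = ∑ j, η j - ∑ j, (A i j : ℝ) * η j := by
        rw [← Finset.sum_sub_distrib]
        exact Finset.sum_congr rfl fun j _ => by ring
      have h2 := ha i
      have h3 := hc i
      push_cast at hb ⊢
      linarith
    obtain ⟨θ, hθ, hcover⟩ := hbal.exists_cover h01 b (fun i => ((b : ℤ) - a i).toNat) (by
      intro y hy
      have hd : ∀ i, ((((b : ℤ) - a i).toNat : ℕ) : ℝ) ≤ ∑ j, (A i j : ℝ) * η j := by
        intro i
        have h0 : (0 : ℝ) ≤ ∑ j, (A i j : ℝ) * η j :=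
          Finset.sum_nonneg fun j _ => mul_nonneg (Nat.cast_nonneg _) (hη j)
        rcases le_total 0 ((b : ℤ) - a i) with h | h
        · have e : ((((b : ℤ) - a i).toNat : ℕ) : ℝ) = (((b : ℤ) - a i : ℤ) : ℝ) := by
            exact_mod_cast Int.toNat_of_nonneg h
          rw [e]
          exact hcov i
        · rw [Int.toNat_of_nonpos h]
          simpa using h0
      have : (∑ i, (((b : ℤ) - a i).toNat : ℝ) * (y i : ℝ)) ≤ b := by
        calc (∑ i, (((b : ℤ) - a i).toNat : ℝ) * (y i : ℝ))
            ≤ ∑ i, (∑ j, (A i j : ℝ) * η j) * (y i : ℝ) :=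
              Finset.sum_le_sum fun i _ => mul_le_mul_of_nonneg_right (hd i) (Nat.cast_nonneg _)
          _ = ∑ j, (∑ i, (y i : ℝ) * (A i j : ℝ)) * η j := by
              simp only [Finset.sum_mul]
              rw [Finset.sum_comm]
              exact Finset.sum_congr rfl fun j _ => Finset.sum_congr rfl fun i _ => by ring
          _ ≤ ∑ j, 1 * η j := Finset.sum_le_sum fun j _ =>
              mul_le_mul_of_nonneg_right (by exact_mod_cast hy j) (hη j)
          _ = b := by
              push_cast at hb
              simp [hb]
      exact_mod_cast this)
    have hpad : ∃ θ' : Fin q → ℕ, (∀ j, θ j ≤ θ' j) ∧ ∑ j, θ' j = b := by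
      rcases Nat.eq_zero_or_pos q with rfl | hq
      · refine ⟨θ, fun _ => le_rfl, ?_⟩
        have hb' : (b : ℝ) = 0 := by simpa using hb
        simpa using (Nat.cast_eq_zero.1 hb').symm
      · refine ⟨fun j => θ j + if j = ⟨0, hq⟩ then b - ∑ j, θ j else 0, fun j => by simp, ?_⟩
        simp only [Finset.sum_add_distrib, Finset.sum_ite_eq', Finset.mem_univ, if_true]
        omega
    obtain ⟨θ', hle, hsum⟩ := hpad
    have hsumZ : (b : ℤ) = ∑ j, (θ' j : ℤ) := by exact_mod_cast hsum.symm
    have hnonneg : ∀ i, 0 ≤ a i - ∑ j, (θ' j : ℤ) * (1 - (A i j : ℤ)) := by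
      intro i
      have h1 : ∑ j, (θ' j : ℤ) * (1 - (A i j : ℤ)) = b - ∑ j, (A i j : ℤ) * (θ' j : ℤ) := by
        rw [hsumZ, ← Finset.sum_sub_distrib]
        exact Finset.sum_congr rfl fun j _ => by ring
      have h2 : ((b : ℤ) - a i).toNat ≤ ∑ j, A i j * θ' j :=
        (hcover i).trans (Finset.sum_le_sum fun j _ => Nat.mul_le_mul_left _ (hle j))
      have h3 : (b : ℤ) - a i ≤ ∑ j, (A i j : ℤ) * (θ' j : ℤ) := by
        have := Int.toNat_le.1 h2
        exact_mod_cast this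
      rw [h1]
      linarith
    refine ⟨fun i => (a i - ∑ j, (θ' j : ℤ) * (1 - (A i j : ℤ))).toNat, θ', fun i => ?_, hsumZ⟩
    simp only [Int.toNat_of_nonneg (hnonneg i)]
    ring
  · rintro ⟨c, η, ha, hb⟩
    refine ⟨fun i => c i, fun j => η j, fun i => Nat.cast_nonneg _, fun j => Nat.cast_nonneg _,
      fun i => ?_, ?_⟩
    · rw [ha i]; push_cast; rfl
    · rw [hb]; push_cast; rfl
end

section
/- Let G be a perfect finite simple graph on vertices x_1,…,x_n with no isolated vertices, let ω_1,…,ω_p ∈ {0,1}^n be the incidence vectors of the non-empty cliques of G, and set ℋ = { (ω_1,|ω_1|−1), …, (ω_p,|ω_p|−1) } ⊂ ℕ^{n+1}, where |ω| denotes the sum of the entries of ω. Then ℕℋ = Cn(I) ∩ ℤ^{n+1}, where ℕℋ is the set of non-negative integer combinations of ℋ and Cn(I) is the Simis cone of the edge ideal I = I(G); that is, ℋ is the integral Hilbert basis of Cn(I). -/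
open Finset

/-- The Simis cone of the edge ideal `I = I(G)`:
`Cn(I) = {a ∈ ℝ^{n+1} : a_i ≥ 0 for all i, and ∑_{x_i∈C_k} a_i ≥ a_{n+1} for
every minimal vertex cover C_k of G}`. -/
def simisCone {n : ℕ} (G : SimpleGraph (Fin n)) : Set ((Fin n → ℝ) × ℝ) :=
  { a | (∀ i, 0 ≤ a.1 i) ∧ 0 ≤ a.2 ∧
      ∀ C : Finset (Fin n), IsMinVCover G C → a.2 ≤ ∑ i ∈ C, a.1 i }

section Multicover

variable {V : Type*} [DecidableEq V]

/-- Double counting: weighting the vertices of `K` by their multiplicity in a family of sets. -/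
theorem sum_countP_mem_mul (M : Multiset (Finset V)) (K : Finset V) (u : V → ℕ) :
    ∑ v ∈ K, M.countP (v ∈ ·) * u v = (M.map fun s => ∑ v ∈ K with v ∈ s, u v).sum := by
  induction M using Multiset.induction_on with
  | empty => simp
  | cons s M ih =>
    simp only [Multiset.countP_cons, add_mul, sum_add_distrib, ih, Multiset.map_cons,
      Multiset.sum_cons, sum_filter, ite_mul, one_mul, zero_mul]
    exact add_comm _ _

theorem sum_countP_mem (M : Multiset (Finset V)) (K : Finset V) :
    ∑ v ∈ K, M.countP (v ∈ ·) = (M.map fun s => #{v ∈ K | v ∈ s}).sum := by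
  simpa using sum_countP_mem_mul M K 1

theorem card_filter_mem_le_one {G : SimpleGraph V} {K s : Finset V}
    (hK : G.IsClique (K : Set V)) (hs : G.IsIndepSet (s : Set V)) :
    #{v ∈ K | v ∈ s} ≤ 1 := by
  rw [card_le_one]
  intro a ha b hb
  rw [mem_filter] at ha hb
  by_contra hab
  exact hs ha.2 hb.2 hab (hK ha.1 hb.1 hab)

variable [Fintype V]

theorem IsPerfect.exists_indepSet_multicover_of_le_one {G : SimpleGraph V} (hG : IsPerfect G)
    {m : ℕ} {w : V → ℕ} (hw : ∀ v, w v ≤ 1)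
    (hm : ∀ K : Finset V, G.IsClique (K : Set V) → ∑ v ∈ K, w v ≤ m) :
    ∃ M : Multiset (Finset V), (∀ s ∈ M, G.IsIndepSet (s : Set V)) ∧ M.card = m ∧
      ∀ v, M.countP (v ∈ ·) = w v := by
  classical
  set A : Set V := {v | w v = 1}
  have hcol : (G.induce A).Colorable m := by
    rw [← SimpleGraph.chromaticNumber_le_iff_colorable, hG A, Nat.cast_le]
    refine csSup_le' ?_
    rintro k ⟨t, ht⟩
    have hcl : G.IsClique ((t.map (Function.Embedding.subtype _) : Finset V) : Set V) := by
      intro a ha b hb hab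
      simp only [coe_map, Set.mem_image, mem_coe] at ha hb
      obtain ⟨a, ha, rfl⟩ := ha
      obtain ⟨b, hb, rfl⟩ := hb
      exact ht.isClique ha hb (fun h => hab (by rw [h]))
    have := hm _ hcl
    rw [sum_map, sum_congr rfl (fun x _ => x.2)] at this
    simpa [ht.card_eq] using this
  obtain ⟨c⟩ := hcol
  refine ⟨(univ : Finset (Fin m)).val.map
    (fun i => univ.filter fun v => ∃ h : v ∈ A, c ⟨v, h⟩ = i), ?_, by simp, ?_⟩
  · intro s hs
    obtain ⟨i, -, rfl⟩ := Multiset.mem_map.1 hs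
    intro a ha b hb _ hadj
    simp only [coe_filter, mem_univ, true_and, Set.mem_ofPred_eq] at ha hb
    obtain ⟨ha, hai⟩ := ha
    obtain ⟨hb, hbi⟩ := hb
    exact c.valid (v := ⟨a, ha⟩) (w := ⟨b, hb⟩) hadj (hai.trans hbi.symm)
  · intro v
    rw [Multiset.countP_map]
    by_cases hv : v ∈ A
    · rw [show w v = 1 from hv, ← Finset.filter_val, Finset.card_val, card_eq_one]
      exact ⟨c ⟨v, hv⟩, by ext i; simp [hv, eq_comm]⟩
    · have : w v = 0 := by have := hw v; have : w v ≠ 1 := hv; omega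
      simp [hv, this]

/-- In a perfect graph, the weighted chromatic number equals the weighted clique number. -/
theorem IsPerfect.exists_indepSet_multicover {G : SimpleGraph V} (hG : IsPerfect G)
    (m : ℕ) (w : V → ℕ) (hm : ∀ K : Finset V, G.IsClique (K : Set V) → ∑ v ∈ K, w v ≤ m) :
    ∃ M : Multiset (Finset V), (∀ s ∈ M, G.IsIndepSet (s : Set V)) ∧ M.card = m ∧
      ∀ v, M.countP (v ∈ ·) = w v := by
  induction hN : ∑ v, w v using Nat.strong_induction_on generalizing m w with
  | _ N ih =>
  by_cases hw : ∀ v, w v ≤ 1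
  · exact hG.exists_indepSet_multicover_of_le_one hw hm
  push Not at hw
  obtain ⟨v, hv⟩ := hw
  -- Lower the weight of `v` by one and take a set `S` through `v` in the resulting family.
  obtain ⟨M, hMi, hMc, hMw⟩ := ih (∑ x, (w x - if x = v then 1 else 0)) (by
      rw [← hN]
      exact sum_lt_sum (fun x _ => Nat.sub_le _ _) ⟨v, mem_univ _, by simp; omega⟩)
    m _ (fun K hK => (sum_le_sum fun x _ => Nat.sub_le _ _).trans (hm K hK)) rfl
  have hpos : 0 < M.countP (v ∈ ·) := by rw [hMw]; simp; omega
  obtain ⟨S, hSM, hvS⟩ := Multiset.countP_pos.1 hpos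
  obtain ⟨M', rfl⟩ := Multiset.exists_cons_of_mem hSM
  have hSi := hMi S hSM
  rw [Multiset.card_cons] at hMc
  have hle : ∀ x, (if x ∈ S then 1 else 0) ≤ w x := by
    intro x
    have := hMw x
    rw [Multiset.countP_cons] at this
    split_ifs with hx
    · rw [if_pos hx] at this; omega
    · exact Nat.zero_le _
  obtain ⟨M'', hi, hc, hw⟩ := ih (∑ x, (w x - if x ∈ S then 1 else 0)) (by
      rw [← hN]
      exact sum_lt_sum (fun x _ => Nat.sub_le _ _) ⟨v, mem_univ _, by simp [hvS]; omega⟩)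
    (m - 1) _ (fun K hK => by
      have hsum : ∑ x ∈ K, (w x - if x ∈ S then 1 else 0) + #{x ∈ K | x ∈ S}
          = ∑ x ∈ K, w x := by
        rw [card_filter, ← sum_add_distrib]
        exact sum_congr rfl fun x _ => Nat.sub_add_cancel (hle x)
      rcases Nat.eq_zero_or_pos #{x ∈ K | x ∈ S} with h0 | h1
      · have hvK : v ∉ K := fun h => by
          rw [card_eq_zero] at h0
          exact notMem_empty v (h0 ▸ mem_filter.2 ⟨h, hvS⟩)
        have h2 := sum_countP_mem (S ::ₘ M') K
        have hMw' : ∀ x ∈ K, (S ::ₘ M').countP (x ∈ ·) = w x := fun x hx => by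
          rw [hMw, if_neg (ne_of_mem_of_not_mem hx hvK), Nat.sub_zero]
        rw [Multiset.map_cons, Multiset.sum_cons, h0, sum_congr rfl hMw',
          zero_add] at h2
        change ∑ x ∈ K, w x = _ at h2
        have h3 : (M'.map fun s => #{x ∈ K | x ∈ s}).sum ≤ M'.card := by
          have := Multiset.sum_le_card_nsmul (M'.map fun s => #{x ∈ K | x ∈ s}) 1 (by
            intro y hy
            obtain ⟨s, hs, rfl⟩ := Multiset.mem_map.1 hy
            exact card_filter_mem_le_one hK (hMi s (Multiset.mem_cons_of_mem hs)))
          simpa using this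
        omega
      · have := hm K hK
        omega) rfl
  refine ⟨S ::ₘ M'', ?_, by rw [Multiset.card_cons]; omega, fun x => ?_⟩
  · intro s hs
    rcases Multiset.mem_cons.1 hs with rfl | hs
    exacts [hSi, hi s hs]
  · rw [Multiset.countP_cons, hw x]
    exact Nat.sub_add_cancel (hle x)

/-- In a perfect graph some clique meets the support of every independent set of maximum weight. -/
theorem IsPerfect.exists_isClique_meeting {G : SimpleGraph V} (hG : IsPerfect G)
    {m : ℕ} (hm0 : 0 < m) {w : V → ℕ}
    (hm : ∀ S : Finset V, G.IsIndepSet (S : Set V) → ∑ v ∈ S, w v ≤ m) :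
    ∃ K : Finset V, G.IsClique (K : Set V) ∧
      ∀ S : Finset V, G.IsIndepSet (S : Set V) → ∑ v ∈ S, w v = m →
        ∃ v ∈ K, v ∈ S ∧ 0 < w v := by
  classical
  by_contra! hcon
  have hcon' : ∀ K : Finset V, ∃ S : Finset V, G.IsClique (K : Set V) →
      G.IsIndepSet (S : Set V) ∧ ∑ v ∈ S, w v = m ∧ ∀ v ∈ K, v ∉ S := by
    intro K
    by_cases hK : G.IsClique (K : Set V)
    · obtain ⟨S, hS, hSm, hSK⟩ := hcon K hK
      refine ⟨{v ∈ S | w v ≠ 0}, fun _ => ⟨hS.mono (coe_subset.2 (filter_subset _ _)), ?_, ?_⟩⟩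
      · rw [sum_filter_ne_zero, hSm]
      · intro v hv hvS
        rw [mem_filter] at hvS
        have := hSK v hv hvS.1
        omega
    · exact ⟨∅, fun h => absurd h hK⟩
  choose S hS using hcon'
  set 𝒦 : Finset (Finset V) := {K | G.IsClique (K : Set V)} with h𝒦
  have hmem : ∀ K, K ∈ 𝒦 ↔ G.IsClique (K : Set V) := by simp [h𝒦]
  obtain ⟨M, hMi, hMc, hMw⟩ := hG.exists_indepSet_multicover (#𝒦 - 1)
    (fun v => (𝒦.val.map S).countP (v ∈ ·)) (by
      intro K hK
      have hsum : (((𝒦.val.map S).map fun s => #{v ∈ K | v ∈ s}).sum)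
          = ∑ L ∈ 𝒦, #{v ∈ K | v ∈ S L} := by
        rw [Multiset.map_map]; rfl
      have h0 : #{v ∈ K | v ∈ S K} = 0 := by
        rw [card_eq_zero, filter_eq_empty_iff]
        exact fun v hv => (hS K hK).2.2 v hv
      rw [sum_countP_mem, hsum, ← add_sum_erase _ _ ((hmem K).2 hK), h0, zero_add,
        ← card_erase_of_mem ((hmem K).2 hK), card_eq_sum_ones]
      exact sum_le_sum fun L hL =>
        card_filter_mem_le_one hK (hS L ((hmem L).1 (mem_of_mem_erase hL))).1)
  have h1 := sum_countP_mem_mul M univ w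
  have h2 := sum_countP_mem_mul (𝒦.val.map S) univ w
  simp only [hMw] at h1
  rw [h1] at h2
  have h3 : (M.map fun s => ∑ v with v ∈ s, w v).sum ≤ (#𝒦 - 1) * m := by
    have := Multiset.sum_le_card_nsmul (M.map fun s => ∑ v with v ∈ s, w v) m (by
      intro y hy
      obtain ⟨s, hs, rfl⟩ := Multiset.mem_map.1 hy
      simpa using hm s (hMi s hs))
    simpa [hMc] using this
  have h4 : ((𝒦.val.map S).map fun s => ∑ v with v ∈ s, w v).sum = #𝒦 * m := by
    rw [Multiset.map_map]
    change ∑ L ∈ 𝒦, ∑ v with v ∈ S L, w v = _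
    simp only [filter_univ_mem]
    rw [sum_congr rfl fun L hL => (hS L ((hmem L).1 hL)).2.1, sum_const, smul_eq_mul]
  have h5 : 0 < #𝒦 := card_pos.2 ⟨∅, (hmem ∅).2 (by simp)⟩
  rw [h2, h4] at h3
  have := Nat.le_of_mul_le_mul_right h3 hm0
  omega

/-- In a perfect graph, the weighted clique covering number equals the weighted independence
number. -/
theorem IsPerfect.exists_isClique_multicover {G : SimpleGraph V} (hG : IsPerfect G)
    (m : ℕ) (w : V → ℕ) (hm : ∀ S : Finset V, G.IsIndepSet (S : Set V) → ∑ v ∈ S, w v ≤ m) :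
    ∃ M : Multiset (Finset V), (∀ s ∈ M, G.IsClique (s : Set V)) ∧ M.card = m ∧
      ∀ v, M.countP (v ∈ ·) = w v := by
  induction m generalizing w with
  | zero =>
    refine ⟨0, by simp, by simp, fun v => ?_⟩
    have := hm {v} (by simp [SimpleGraph.IsIndepSet])
    simp at this
    simp [this]
  | succ m ih =>
    obtain ⟨K, hK, hKS⟩ := hG.exists_isClique_meeting m.succ_pos hm
    obtain ⟨M, hMc, hMm, hMw⟩ := ih (fun v => w v - if v ∈ K then 1 else 0) (by
      intro S hS
      by_cases hSm : ∑ v ∈ S, w v = m + 1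
      · obtain ⟨v, hvK, hvS, hv⟩ := hKS S hS hSm
        rw [← Nat.lt_succ_iff, Nat.succ_eq_add_one, ← hSm]
        exact sum_lt_sum (fun x _ => Nat.sub_le _ _) ⟨v, hvS, by simp [hvK, hv]⟩
      · have := hm S hS
        have : ∑ v ∈ S, (w v - if v ∈ K then 1 else 0) ≤ ∑ v ∈ S, w v :=
          sum_le_sum fun x _ => Nat.sub_le _ _
        omega)
    refine ⟨{v ∈ K | 0 < w v} ::ₘ M, ?_, by simp [hMm], fun v => ?_⟩
    · intro s hs
      rcases Multiset.mem_cons.1 hs with rfl | hs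
      exacts [hK.subset (coe_subset.2 (filter_subset _ _)), hMc s hs]
    · rw [Multiset.countP_cons, hMw]
      simp only [mem_filter]
      by_cases h : v ∈ K <;> by_cases hpos : 0 < w v <;> simp [h, hpos] <;> omega

/-- Cliques of a multicover can be split until any prescribed number of them, up to the total
weight, is reached. -/
theorem exists_isClique_multicover_card_eq {G : SimpleGraph V} {w : V → ℕ}
    {M : Multiset (Finset V)} (hM : ∀ s ∈ M, G.IsClique (s : Set V) ∧ s.Nonempty)
    (hw : ∀ v, M.countP (v ∈ ·) = w v) {m : ℕ} (hMm : M.card ≤ m) (hm : m ≤ ∑ v, w v) :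
    ∃ N : Multiset (Finset V), (∀ s ∈ N, G.IsClique (s : Set V) ∧ s.Nonempty) ∧ N.card = m ∧
      ∀ v, N.countP (v ∈ ·) = w v := by
  induction m, hMm using Nat.le_induction with
  | base => exact ⟨M, hM, rfl, hw⟩
  | succ m _ ih =>
    obtain ⟨N, hN, hNm, hNw⟩ := ih (by omega)
    have hex : ∃ K ∈ N, 1 < #K := by
      by_contra! h
      have h1 := sum_countP_mem N univ
      simp only [hNw, filter_univ_mem] at h1
      have h2 := Multiset.sum_le_card_nsmul (N.map card) 1 (by simpa using h)
      rw [Multiset.card_map, smul_eq_mul, mul_one] at h2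
      have : (N.map fun s => #s).sum = (N.map card).sum := rfl
      omega
    obtain ⟨K, hKN, hK⟩ := hex
    obtain ⟨v, hv⟩ := (hN K hKN).2
    obtain ⟨N', rfl⟩ := Multiset.exists_cons_of_mem hKN
    refine ⟨{v} ::ₘ K.erase v ::ₘ N', ?_, by simpa using hNm, fun x => ?_⟩
    · intro s hs
      rcases Multiset.mem_cons.1 hs with rfl | hs
      · simp
      rcases Multiset.mem_cons.1 hs with rfl | hs
      · refine ⟨(hN K hKN).1.subset (coe_subset.2 (erase_subset _ _)), ?_⟩
        rw [← card_pos, card_erase_of_mem hv]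
        omega
      · exact hN s (Multiset.mem_cons_of_mem hs)
    · rw [← hNw x]
      simp only [Multiset.countP_cons, mem_singleton, mem_erase]
      by_cases hx : x = v
      · subst hx; simp [hv]
      · simp [hx]

theorem sum_count_mul_eq (M : Multiset (Finset V)) (f : Finset V → ℤ) :
    ∑ K, (M.count K : ℤ) * f K = (M.map f).sum := by
  rw [sum_multiset_map_count]
  simp only [nsmul_eq_mul]
  refine (sum_subset (subset_univ _) fun K _ hK => ?_).symm
  rw [Multiset.mem_toFinset] at hK
  simp [Multiset.count_eq_zero_of_notMem hK]

end Multicover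

theorem IsVCover.exists_isMinVCover_subset {n : ℕ} {G : SimpleGraph (Fin n)}
    {C : Finset (Fin n)} (hC : IsVCover G C) : ∃ D ⊆ C, IsMinVCover G D := by
  induction C using Finset.strongInduction with
  | H C ih =>
  by_cases h : ∃ D, D ⊂ C ∧ IsVCover G D
  · obtain ⟨D, hDC, hD⟩ := h
    obtain ⟨E, hED, hE⟩ := ih D hDC hD
    exact ⟨E, hED.trans hDC.subset, hE⟩
  · push Not at h
    exact ⟨C, Subset.rfl, hC, h⟩

theorem IsVCover.card_sub_one_le {n : ℕ} {G : SimpleGraph (Fin n)} {C K : Finset (Fin n)}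
    (hC : IsVCover G C) (hK : G.IsClique (K : Set (Fin n))) :
    #K - 1 ≤ #{i ∈ C | i ∈ K} := by
  have h1 : #(K \ C) ≤ 1 := by
    rw [card_le_one]
    intro a ha b hb
    rw [mem_sdiff] at ha hb
    by_contra hab
    rcases hC (hK ha.1 hb.1 hab) with h | h
    exacts [ha.2 h, hb.2 h]
  have h2 := card_sdiff_add_card_inter K C
  rw [filter_mem_eq_inter, inter_comm]
  omega

/-- Let `G` be a perfect graph with no isolated vertices,
let `ω_1,…,ω_p` be the incidence vectors of the non-empty cliques of `G`, and
`ℋ = {(ω_1,|ω_1|−1),…,(ω_p,|ω_p|−1)}`. Then `ℕℋ = Cn(I(G)) ∩ ℤ^{n+1}`, i.e.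
`ℋ` is the integral Hilbert basis of the Simis cone: an integral vector lies
in the Simis cone iff it is a non-negative integer combination of `ℋ`. -/
theorem simisCone_hilbertBasis_of_perfect {n : ℕ} (G : SimpleGraph (Fin n))
    (hiso : ∀ v : Fin n, ∃ w : Fin n, G.Adj v w)
    (hperf : IsPerfect G) :
    ∀ z : (Fin n → ℤ) × ℤ,
      ((fun i => (z.1 i : ℝ)), (z.2 : ℝ)) ∈ simisCone G ↔
      ∃ η : Finset (Fin n) → ℕ,
        (∀ K, η K ≠ 0 → G.IsClique (K : Set (Fin n)) ∧ K.Nonempty) ∧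
        (∀ i, z.1 i = ∑ K : Finset (Fin n), (η K : ℤ) * (if i ∈ K then 1 else 0)) ∧
        z.2 = ∑ K : Finset (Fin n), (η K : ℤ) * ((K.card : ℤ) - 1) := by
  rintro ⟨a, b⟩
  constructor
  · rintro ⟨ha, hb, hcov⟩
    dsimp only at ha hb hcov
    have ha' : ∀ i, 0 ≤ a i := fun i => by exact_mod_cast ha i
    have hb' : 0 ≤ b := by exact_mod_cast hb
    lift a to Fin n → ℕ using ha'
    have hindep : ∀ S : Finset (Fin n), G.IsIndepSet (S : Set (Fin n)) →
        (∑ i ∈ S, a i : ℤ) ≤ ∑ i, (a i : ℤ) - b := by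
      intro S hS
      have hC : IsVCover G Sᶜ := by
        intro x y hxy
        simp only [mem_compl]
        by_contra! h
        exact hS h.1 h.2 hxy.ne hxy
      obtain ⟨D, hDS, hD⟩ := hC.exists_isMinVCover_subset
      have h1 : b ≤ ∑ i ∈ D, (a i : ℤ) := by exact_mod_cast hcov D hD
      have h2 : ∑ i ∈ D, (a i : ℤ) ≤ ∑ i ∈ Sᶜ, (a i : ℤ) :=
        sum_le_sum_of_subset_of_nonneg hDS fun i _ _ => Int.natCast_nonneg _
      have h3 := sum_add_sum_compl S fun i => (a i : ℤ)
      omega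
    obtain ⟨m, hm⟩ := Int.eq_ofNat_of_zero_le
      (show 0 ≤ ∑ i, (a i : ℤ) - b by simpa using hindep ∅ (by simp [SimpleGraph.IsIndepSet]))
    rw [hm] at hindep
    obtain ⟨M, hMc, hMm, hMa⟩ := hperf.exists_isClique_multicover m a fun S hS => by
      exact_mod_cast hindep S hS
    obtain ⟨N, hN, hNm, hNa⟩ := exists_isClique_multicover_card_eq
      (M := M.filter Finset.Nonempty) (G := G) (w := a) (m := m)
      (fun s hs => by
        rw [Multiset.mem_filter] at hs
        exact ⟨hMc s hs.1, hs.2⟩)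
      (fun v => by
        rw [Multiset.countP_filter, ← hMa v]
        exact Multiset.countP_congr rfl fun s _ => by
          simpa using fun hv => ⟨v, hv⟩)
      ((Multiset.card_le_card (Multiset.filter_le _ _)).trans hMm.le)
      (by zify; omega)
    refine ⟨fun K => N.count K, fun K hK => hN K (Multiset.count_ne_zero.1 hK), fun i => ?_, ?_⟩
    · rw [sum_count_mul_eq]
      change (a i : ℤ) = _
      rw [← hNa i]
      clear * -
      induction N using Multiset.induction_on with
      | empty => simp
      | cons s N ih =>
        rw [Multiset.countP_cons, Multiset.map_cons, Multiset.sum_cons, ← ih]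
        split_ifs <;> simp [add_comm]
    · rw [sum_count_mul_eq]
      have h1 := sum_countP_mem N univ
      simp only [hNa, filter_univ_mem] at h1
      have h1' : ∑ i, (a i : ℤ) = ((N.map fun s => #s).sum : ℕ) := by exact_mod_cast h1
      rw [Multiset.sum_map_sub]
      simp only [Multiset.map_const', Multiset.sum_replicate, hNm, nsmul_eq_mul, mul_one]
      change b = _
      have h2 : (N.map fun s => (#s : ℤ)).sum = ((N.map fun s => #s).sum : ℕ) := by
        rw [Nat.cast_multiset_sum, Multiset.map_map]
        rfl
      omega
  · rintro ⟨η, hη, ha, hb⟩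
    dsimp only at ha hb
    have hterm : ∀ K : Finset (Fin n), 0 ≤ (η K : ℤ) * ((K.card : ℤ) - 1) := by
      intro K
      by_cases hK : η K = 0
      · simp [hK]
      · have := card_pos.2 (hη K hK).2
        exact mul_nonneg (Int.natCast_nonneg _) (by omega)
    have ha' : ∀ i, 0 ≤ a i := fun i => by
      rw [ha i]
      exact sum_nonneg fun K _ => mul_nonneg (Int.natCast_nonneg _) (by split_ifs <;> simp)
    have hb' : 0 ≤ b := hb ▸ sum_nonneg fun K _ => hterm K
    refine ⟨fun i => Int.cast_nonneg (ha' i), Int.cast_nonneg hb', fun C hC => ?_⟩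
    dsimp only
    have key : b ≤ ∑ i ∈ C, a i := by
      rw [hb, sum_congr rfl fun i _ => ha i, sum_comm]
      refine sum_le_sum fun K _ => ?_
      rw [← mul_sum]
      by_cases hK : η K = 0
      · simp [hK]
      · refine mul_le_mul_of_nonneg_left ?_ (Int.natCast_nonneg _)
        have := hC.1.card_sub_one_le (hη K hK).1
        rw [sum_boole]
        omega
    exact_mod_cast key
end

section
/- If G is the complete graph on vertices x_1,…,x_n (n ≥ 2), then the symbolic Rees algebra of its edge ideal is R_s(I(G)) = K[ x^a t^r : x^a a square-free monomial of degree r+1, r ≥ 0 ], as subalgebras of R[t]. -/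
open Finset

/-- The `i`-th symbolic power of the edge ideal of the complete graph on `n`
vertices: `I^{(i)} = 𝔭_1^i ∩ ⋯ ∩ 𝔭_n^i`, where `𝔭_m` is the (minimal prime)
ideal generated by all variables except `x_m`. -/
noncomputable def symbolicPowerComplete (n : ℕ) (k : Type*) [Field k]
    (i : ℕ) : Ideal (MvPolynomial (Fin n) k) :=
  ⨅ m : Fin n,
    (Ideal.span (MvPolynomial.X '' { j : Fin n | j ≠ m })) ^ i

section

open MvPolynomial

/-- Exponents of polynomials in the `i`-th power of the ideal generated by all variables but
`x_m` have degree at least `i` outside of `x_m`. -/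
lemma add_le_degree_of_mem_span_X_pow {σ k : Type*} [Field k] {m : σ} {i : ℕ}
    {f : MvPolynomial σ k} (hf : f ∈ Ideal.span (X '' {j : σ | j ≠ m}) ^ i)
    {a : σ →₀ ℕ} (ha : a ∈ f.support) : i + a m ≤ a.degree := by
  have hle : Ideal.span (X '' {j : σ | j ≠ m}) ^ i ≤
      Ideal.span ((fun d => monomial d (1 : k)) '' {d : σ →₀ ℕ | i + d m ≤ d.degree}) := by
    clear hf ha
    induction i with
    | zero =>
      rw [pow_zero, Ideal.one_eq_top, top_le_iff, Ideal.eq_top_iff_one]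
      exact Ideal.subset_span ⟨0, by simp, rfl⟩
    | succ i ih =>
      rw [pow_succ]
      refine (Ideal.mul_mono_left ih).trans ?_
      rw [Ideal.span_mul_span', Ideal.span_le]
      rintro _ ⟨_, ⟨d, hd, rfl⟩, _, ⟨j, hj, rfl⟩, rfl⟩
      refine Ideal.subset_span ⟨d + Finsupp.single j 1, ?_, ?_⟩
      · have hjm : (Finsupp.single j 1 : σ →₀ ℕ) m = 0 := Finsupp.single_eq_of_ne' hj
        simp only [Set.mem_ofPred_eq, Finsupp.add_apply, map_add, hjm,
          Finsupp.degree_single] at hd ⊢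
        omega
      · simp [X, monomial_mul]
  obtain ⟨d, hd, hda⟩ := mem_ideal_span_monomial_image.1 (hle hf) a ha
  obtain ⟨c, rfl⟩ := exists_add_of_le hda
  have hc := Finsupp.le_degree m c
  simp only [Set.mem_ofPred_eq, Finsupp.add_apply, map_add] at hd ⊢
  omega

lemma prod_X_mem_symbolicPowerComplete {n : ℕ} (k : Type*) [Field k] {S : Finset (Fin n)}
    {r : ℕ} (hS : S.card = r + 1) :
    ∏ i ∈ S, X i ∈ symbolicPowerComplete n k r := by
  refine (Submodule.mem_iInf _).2 fun m => ?_
  have hprod : ∏ i ∈ S.erase m, (X i : MvPolynomial (Fin n) k) ∈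
      Ideal.span (X '' {j : Fin n | j ≠ m}) ^ (S.erase m).card := by
    rw [← Finset.prod_const]
    exact Ideal.prod_mem_prod fun j hj =>
      Ideal.subset_span ⟨j, Finset.ne_of_mem_erase hj, rfl⟩
  have hcard : r ≤ (S.erase m).card := by
    have := Finset.pred_card_le_card_erase (s := S) (a := m)
    omega
  rw [← Finset.prod_sdiff (Finset.erase_subset m S)]
  exact Ideal.mul_mem_left _ _ (Ideal.pow_le_pow_right hcard hprod)

lemma mul_mem_symbolicPowerComplete {n : ℕ} {k : Type*} [Field k] {i j : ℕ}
    {f g : MvPolynomial (Fin n) k} (hf : f ∈ symbolicPowerComplete n k i)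
    (hg : g ∈ symbolicPowerComplete n k j) : f * g ∈ symbolicPowerComplete n k (i + j) := by
  refine (Submodule.mem_iInf _).2 fun m => ?_
  rw [pow_add]
  exact Ideal.mul_mem_mul ((Submodule.mem_iInf _).1 hf m) ((Submodule.mem_iInf _).1 hg m)

/-- A subalgebra containing all `x^S t^r` with `|S| = r + 1` contains `x^a t^i` as soon as
`i ≤ |a| - max a`. -/
lemma monomial_monomial_mem_of_add_le_degree {n : ℕ} {k : Type*} [Field k] (hn : 0 < n)
    {A : Subalgebra k (Polynomial (MvPolynomial (Fin n) k))}
    (hA : ∀ (S : Finset (Fin n)) (r : ℕ), S.card = r + 1 →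
      Polynomial.monomial r (∏ i ∈ S, X i) ∈ A)
    (a : Fin n →₀ ℕ) (i : ℕ) (ha : ∀ m, i + a m ≤ a.degree) :
    Polynomial.monomial i (monomial a (1 : k)) ∈ A := by
  induction hd : a.degree using Nat.strong_induction_on generalizing a i with
  | _ d ih =>
  subst hd
  rcases eq_or_ne a 0 with rfl | ha0
  · obtain rfl : i = 0 := by simpa using ha ⟨0, hn⟩
    exact A.one_mem
  have hpos : 0 < a.support.card := Finset.card_pos.2 (Finsupp.support_nonempty_iff.2 ha0)
  obtain ⟨T, hTa, hT⟩ := Finset.exists_subset_card_eq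
    (show min (i + 1) a.support.card ≤ a.support.card from min_le_right _ _)
  set e : Fin n →₀ ℕ := ∑ j ∈ T, Finsupp.single j 1 with he
  have he_apply (m : Fin n) : e m = if m ∈ T then 1 else 0 := by
    simp [he, Finsupp.finsetSum_apply, Finsupp.single_apply]
  have he_degree : e.degree = T.card := by simp [he]
  have he_monomial : monomial e (1 : k) = ∏ j ∈ T, X j := by
    rw [he, monomial_sum_one]; rfl
  have hea : e ≤ a := fun m => by
    rw [he_apply]
    split_ifs with h
    · exact Nat.one_le_iff_ne_zero.2 (Finsupp.mem_support_iff.1 (hTa h))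
    · exact Nat.zero_le _
  obtain ⟨b, rfl⟩ := exists_add_of_le hea
  rw [map_add] at ha ih
  have hb : ∀ m, i - (T.card - 1) + b m ≤ b.degree := fun m => by
    have ham := ha m
    have hbm := Finsupp.le_degree m b
    rw [Finsupp.add_apply, he_apply] at ham
    rcases le_or_gt (i + 1) (e + b).support.card with h | h
    · omega
    · have hTs : T = (e + b).support := Finset.eq_of_subset_of_card_le hTa (by omega)
      by_cases hmT : m ∈ T
      · rw [if_pos hmT] at ham
        omega
      · have hbm0 : b m = 0 := by
          have : (e + b) m = 0 := Finsupp.notMem_support_iff.1 (hTs ▸ hmT)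
          rw [Finsupp.add_apply] at this
          omega
        obtain ⟨l, hl⟩ := Finset.card_pos.1 (show 0 < T.card by omega)
        have hal := ha l
        rw [Finsupp.add_apply, he_apply, if_pos hl] at hal
        omega
  have hmul := A.mul_mem (hA T (T.card - 1) (by omega))
    (ih b.degree (by omega) b (i - (T.card - 1)) hb rfl)
  rw [← he_monomial, Polynomial.monomial_mul_monomial, monomial_mul, one_mul,
    show T.card - 1 + (i - (T.card - 1)) = i by omega] at hmul
  exact hmul

end

/-- If `G` is the complete graph on `x_1,…,x_n` (`n ≥ 2`),
then the symbolic Rees algebra of its edge ideal, i.e. the subset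
`⊕_{i≥0} I(G)^{(i)} t^i = {f ∈ R[t] : coeff_i f ∈ I(G)^{(i)} for all i}` of
`R[t]`, equals the `K`-subalgebra of `R[t]` generated by the monomials
`x^a t^r` with `x^a` square-free of degree `r + 1`, `r ≥ 0`. -/
theorem symbolicReesAlgebra_completeGraph {n : ℕ} (hn : 2 ≤ n)
    (k : Type*) [Field k] :
    (Algebra.adjoin k
      { f : Polynomial (MvPolynomial (Fin n) k) |
        ∃ (S : Finset (Fin n)) (r : ℕ), S.card = r + 1 ∧
          f = Polynomial.monomial r (∏ i ∈ S, MvPolynomial.X i) } :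
        Set (Polynomial (MvPolynomial (Fin n) k))) =
    { f : Polynomial (MvPolynomial (Fin n) k) |
      ∀ i : ℕ, f.coeff i ∈ symbolicPowerComplete n k i } := by
  refine Set.Subset.antisymm (fun f hf => ?_) fun f hf => ?_
  · induction hf using Algebra.adjoin_induction with
    | mem f hf =>
      obtain ⟨S, r, hS, rfl⟩ := hf
      intro i
      rw [Polynomial.coeff_monomial]
      split_ifs with h
      · exact h ▸ prod_X_mem_symbolicPowerComplete k hS
      · exact zero_mem _
    | algebraMap c =>
      intro i
      rw [Polynomial.algebraMap_apply, Polynomial.coeff_C]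
      split_ifs with h
      · simp [h, symbolicPowerComplete]
      · exact zero_mem _
    | add f g _ _ hf hg =>
      intro i
      rw [Polynomial.coeff_add]
      exact add_mem (hf i) (hg i)
    | mul f g _ _ hf hg =>
      intro i
      rw [Polynomial.coeff_mul]
      refine sum_mem fun p hp => ?_
      rw [← Finset.HasAntidiagonal.mem_antidiagonal.1 hp]
      exact mul_mem_symbolicPowerComplete (hf p.1) (hg p.2)
  · rw [SetLike.mem_coe, f.as_sum_support]
    refine sum_mem fun i _ => ?_
    rw [(f.coeff i).as_sum, map_sum]
    refine sum_mem fun a ha => ?_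
    rw [← mul_one (MvPolynomial.coeff a (f.coeff i)), ← smul_eq_mul,
      ← MvPolynomial.smul_monomial, ← Polynomial.smul_monomial]
    refine Subalgebra.smul_mem _ ?_ _
    refine monomial_monomial_mem_of_add_le_degree (by omega)
      (fun S r hS => Algebra.subset_adjoin ?_) a i fun m => ?_
    · exact ⟨S, r, hS, rfl⟩
    · exact add_le_degree_of_mem_span_X_pow ((Submodule.mem_iInf _).1 (hf i) m) ha
end

section
/- Let G be a perfect finite simple graph on vertices x_1,…,x_n with no isolated vertices, let ω_0 = 0 and let ω_1,…,ω_p ∈ {0,1}^n be the incidence vectors of the non-empty cliques of G. Then the monomial subring K[{x^{ω_i} t : 0 ≤ i ≤ p}] ⊂ K[x_1,…,x_n,t] is normal; equivalently, every lattice point (a,b) ∈ ℤ^{n+1} of the cone of non-negative real combinations of (ω_0,1),(ω_1,1),…,(ω_p,1) is a non-negative integer combination of (ω_0,1),(ω_1,1),…,(ω_p,1). -/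
open Finset

/-- Every weighting `w` of the vertices whose weight on each clique is at most `m` is the sum of
the incidence vectors of `m` independent sets. -/
def HasWeightedColorings {V : Type*} [DecidableEq V] (G : SimpleGraph V) : Prop :=
  ∀ (w : V → ℕ) (m : ℕ),
    (∀ C : Finset V, G.IsClique (C : Set V) → ∑ x ∈ C, w x ≤ m) →
    ∃ s : Multiset (Finset V), s.card = m ∧ (∀ S ∈ s, Gᶜ.IsClique (S : Set V)) ∧
      ∀ x, w x = (s.map fun S => if x ∈ S then 1 else 0).sum

lemma card_inter_le_one {V : Type*} [DecidableEq V] {G : SimpleGraph V} {C S : Finset V}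
    (hC : G.IsClique (C : Set V))
    (hS : Gᶜ.IsClique (S : Set V)) : (C ∩ S).card ≤ 1 := by
  rw [Finset.card_le_one]
  intro a ha b hb
  rw [Finset.mem_inter] at ha hb
  by_contra hab
  have h := hS (Finset.mem_coe.2 ha.2) (Finset.mem_coe.2 hb.2) hab
  rw [SimpleGraph.compl_adj] at h
  exact h.2 (hC (Finset.mem_coe.2 ha.1) (Finset.mem_coe.2 hb.1) hab)

section WeightedColorings

variable {V : Type*} [Fintype V] [DecidableEq V]

lemma sum_mul_eq_sum_map (s : Multiset (Finset V)) (w f : V → ℕ)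
    (hw : ∀ x, w x = (s.map fun S => if x ∈ S then 1 else 0).sum) :
    ∑ x, f x * w x = (s.map fun S => ∑ x ∈ S, f x).sum := by
  simp only [hw]
  clear hw
  induction s using Multiset.induction_on with
  | empty => simp
  | cons S s ih =>
    simp only [Multiset.map_cons, Multiset.sum_cons, mul_add, Finset.sum_add_distrib, ih]
    simp

/-- Weights at most one: an ordinary coloring of the subgraph induced on the support. -/
lemma exists_coloring_of_le_one {G : SimpleGraph V} (hG : IsPerfect G) (w : V → ℕ) (m : ℕ)
    (hw : ∀ x, w x ≤ 1)
    (hm : ∀ C : Finset V, G.IsClique (C : Set V) → ∑ x ∈ C, w x ≤ m) :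
    ∃ s : Multiset (Finset V), s.card = m ∧ (∀ S ∈ s, Gᶜ.IsClique (S : Set V)) ∧
      ∀ x, w x = (s.map fun S => if x ∈ S then 1 else 0).sum := by
  classical
  set U : Set V := {x | w x = 1} with hU
  have hcol : (G.induce U).Colorable m := by
    rw [← SimpleGraph.chromaticNumber_le_iff_colorable, hG U]
    norm_cast
    refine csSup_le ⟨0, ∅, by simp [SimpleGraph.isNClique_iff]⟩ ?_
    rintro k ⟨t, ht⟩
    have hcl : G.IsClique ((t.map (Function.Embedding.subtype _) : Finset V) : Set V) := by
      intro a ha b hb hab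
      simp only [Finset.coe_map, Set.mem_image, Finset.mem_coe] at ha hb
      obtain ⟨a', ha', rfl⟩ := ha
      obtain ⟨b', hb', rfl⟩ := hb
      exact ht.1 ha' hb' (fun h => hab (by rw [h]))
    have h := hm _ hcl
    rw [Finset.sum_map] at h
    have h1 : ∑ x ∈ t, w (Function.Embedding.subtype (· ∈ U) x) = t.card := by
      rw [Finset.card_eq_sum_ones]
      exact Finset.sum_congr rfl fun x _ => x.2
    rw [← ht.2]
    exact h1 ▸ h
  obtain ⟨c⟩ := hcol
  refine ⟨(Finset.univ : Finset (Fin m)).val.map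
    fun j => Finset.univ.filter fun x => ∃ h : x ∈ U, c ⟨x, h⟩ = j, by simp, ?_, ?_⟩
  · intro S hS
    simp only [Multiset.mem_map, Finset.mem_val] at hS
    obtain ⟨j, -, rfl⟩ := hS
    intro a ha b hb hab
    simp only [Finset.coe_filter, Finset.mem_univ, true_and, Set.mem_ofPred_eq] at ha hb
    obtain ⟨ha, hca⟩ := ha
    obtain ⟨hb, hcb⟩ := hb
    rw [SimpleGraph.compl_adj]
    exact ⟨hab, fun h => c.valid (v := ⟨a, ha⟩) (w := ⟨b, hb⟩) h (hca.trans hcb.symm)⟩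
  · intro x
    rw [Multiset.map_map]
    change w x = ∑ j : Fin m, _
    by_cases hx : w x = 1
    · have hxU : x ∈ U := hx
      simp [hxU, hx]
    · have hxU : x ∉ U := hx
      have := hw x
      simp [hxU]
      omega

theorem IsPerfect.hasWeightedColorings {G : SimpleGraph V} (hG : IsPerfect G) :
    HasWeightedColorings G := by
  intro w
  induction hN : ∑ x, w x using Nat.strong_induction_on generalizing w with
  | _ N ih =>
  intro m hm
  by_cases hw : ∀ x, w x ≤ 1
  · exact exists_coloring_of_le_one hG w m hw hm
  push Not at hw
  obtain ⟨x, hx⟩ := hw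
  obtain ⟨w', hw'⟩ : ∃ w' : V → ℕ, ∀ y, w y = w' y + if y = x then 1 else 0 :=
    ⟨fun y => w y - if y = x then 1 else 0, fun y => by
      by_cases h : y = x
      · subst h; simp; omega
      · simp [h]⟩
  have hsum : ∑ y, w y = ∑ y, w' y + 1 := by
    simp [hw', Finset.sum_add_distrib]
  obtain ⟨s, hcard, hind, hs⟩ := ih _ (by omega) w' rfl m fun C hC =>
    (Finset.sum_le_sum fun y _ => by rw [hw' y]; omega).trans (hm C hC)
  obtain ⟨T, hT, hxT⟩ : ∃ T ∈ s, x ∈ T := by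
    by_contra! hne
    have h0 : w' x = 0 := by
      rw [hs x]
      refine Multiset.sum_eq_zero fun k hk => ?_
      obtain ⟨S, hS, rfl⟩ := Multiset.mem_map.1 hk
      simp [hne S hS]
    have := hw' x
    simp at this
    omega
  obtain ⟨r, rfl⟩ := Multiset.exists_cons_of_mem hT
  have hTind := hind T (Multiset.mem_cons_self _ _)
  obtain ⟨u, hu⟩ : ∃ u : V → ℕ, ∀ y, w y = u y + if y ∈ T then 1 else 0 :=
    ⟨fun y => (r.map fun S => if y ∈ S then 1 else 0).sum + if y = x then 1 else 0, fun y => by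
      rw [hw' y, hs y, Multiset.map_cons, Multiset.sum_cons]
      ring⟩
  have hucard : ∀ C : Finset V, ∑ y ∈ C, w y = ∑ y ∈ C, u y + (C ∩ T).card := by
    intro C
    simp [hu, Finset.sum_add_distrib]
  have hur : ∀ y, u y = (r.map fun S => if y ∈ S then 1 else 0).sum + if y = x then 1 else 0 := by
    intro y
    have h1 := hw' y
    have h2 := hu y
    rw [hs y, Multiset.map_cons, Multiset.sum_cons] at h1
    omega
  rw [Multiset.card_cons] at hcard
  have hTpos : 0 < T.card := Finset.card_pos.2 ⟨x, hxT⟩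
  have huniv := hucard Finset.univ
  rw [Finset.univ_inter] at huniv
  obtain ⟨q, hqcard, hqind, hq⟩ := ih _ (by omega) u rfl r.card fun C hC => by
    by_cases hxC : x ∈ C
    · have h1 : 0 < (C ∩ T).card := Finset.card_pos.2 ⟨x, Finset.mem_inter.2 ⟨hxC, hxT⟩⟩
      have h2 := hucard C
      have h3 := hm C hC
      omega
    · have h1 : ∑ y ∈ C, u y = ∑ y, (if y ∈ C then 1 else 0) *
          (r.map fun S => if y ∈ S then 1 else 0).sum := by
        simp only [ite_mul, one_mul, zero_mul, Finset.sum_ite_mem, Finset.univ_inter]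
        refine Finset.sum_congr rfl fun y hy => ?_
        rw [hur y, if_neg (ne_of_mem_of_not_mem hy hxC), add_zero]
      rw [h1, sum_mul_eq_sum_map r _ _ fun _ => rfl]
      have h2 := Multiset.sum_le_card_nsmul
        (r.map fun S => ∑ y ∈ S, if y ∈ C then 1 else 0) 1 fun k hk => by
          obtain ⟨S, hS, rfl⟩ := Multiset.mem_map.1 hk
          have h := card_inter_le_one hC (hind S (Multiset.mem_cons_of_mem hS))
          rw [Finset.inter_comm] at h
          simpa using h
      simpa using h2
  refine ⟨T ::ₘ q, by rw [Multiset.card_cons, hqcard, hcard], ?_, fun y => ?_⟩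
  · intro S hS
    rcases Multiset.mem_cons.1 hS with rfl | hS
    · exact hTind
    · exact hqind S hS
  · rw [Multiset.map_cons, Multiset.sum_cons, ← hq y, hu y, add_comm]

/-- Some clique in the support of `a` meets every independent set of maximum weight. -/
lemma HasWeightedColorings.exists_clique_meeting {G : SimpleGraph V}
    (hG : HasWeightedColorings G) (a : V → ℕ) (b : ℕ) (hb : 0 < b)
    (ha : ∀ S : Finset V, Gᶜ.IsClique (S : Set V) → ∑ x ∈ S, a x ≤ b) :
    ∃ K : Finset V, G.IsClique (K : Set V) ∧ (∀ x ∈ K, 0 < a x) ∧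
      ∀ S : Finset V, Gᶜ.IsClique (S : Set V) → ∑ x ∈ S, a x = b → (K ∩ S).Nonempty := by
  classical
  by_contra! hne
  have hex : ∀ K : Finset V, ∃ S : Finset V, G.IsClique (K : Set V) →
      Gᶜ.IsClique (S : Set V) ∧ ∑ x ∈ S, a x = b ∧ K ∩ S = ∅ := by
    intro K
    by_cases hK : G.IsClique (K : Set V)
    · obtain ⟨S, hS, hSb, hKS⟩ := hne (K.filter fun x => 0 < a x)
        (hK.subset (Finset.coe_subset.2 (Finset.filter_subset _ _))) (by simp)
      refine ⟨S.filter fun x => 0 < a x, fun _ =>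
        ⟨hS.subset (Finset.coe_subset.2 (Finset.filter_subset _ _)), ?_, ?_⟩⟩
      · rw [← hSb]
        refine Finset.sum_filter_of_ne fun x _ hx => Nat.pos_of_ne_zero hx
      · rw [← hKS]
        ext x
        simp only [Finset.mem_inter, Finset.mem_filter]
        tauto
    · exact ⟨∅, fun h => absurd h hK⟩
  choose f hf using hex
  set F : Finset (Finset V) := Finset.univ.filter fun K => G.IsClique (K : Set V) with hF
  have hFpos : 0 < F.card := Finset.card_pos.2 ⟨∅, by simp [hF]⟩
  obtain ⟨s, hcard, hind, hs⟩ := hG (fun x => ∑ K ∈ F, if x ∈ f K then 1 else 0) (F.card - 1)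
    fun C hC => by
      have hCF : C ∈ F := by simp [hF, hC]
      rw [Finset.sum_comm, ← Finset.add_sum_erase _ _ hCF, ← Finset.card_erase_of_mem hCF,
        Finset.card_eq_sum_ones]
      have h0 : (∑ x ∈ C, if x ∈ f C then 1 else 0) = 0 := by
        simp [(hf C hC).2.2]
      rw [h0, zero_add]
      refine Finset.sum_le_sum fun K hK => ?_
      have hK' : G.IsClique (K : Set V) := by
        simpa [hF] using Finset.mem_of_mem_erase hK
      simpa using card_inter_le_one hC (hf K hK').1
  have h1 := sum_mul_eq_sum_map s _ a hs
  have h2 : ∑ x, a x * (∑ K ∈ F, if x ∈ f K then 1 else 0) = F.card * b := by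
    simp only [Finset.mul_sum]
    rw [Finset.sum_comm, Finset.card_eq_sum_ones, Finset.sum_mul]
    refine Finset.sum_congr rfl fun K hK => ?_
    have hK' : G.IsClique (K : Set V) := by simpa [hF] using hK
    simpa using (hf K hK').2.1
  have h3 := Multiset.sum_le_card_nsmul (s.map fun S => ∑ x ∈ S, a x) b fun k hk => by
    obtain ⟨S, hS, rfl⟩ := Multiset.mem_map.1 hk
    exact ha S (hind S hS)
  rw [← h1, h2, Multiset.card_map, hcard, smul_eq_mul] at h3
  have := Nat.le_of_mul_le_mul_right h3 hb
  omega

theorem HasWeightedColorings.compl {G : SimpleGraph V} (hG : HasWeightedColorings G) :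
    HasWeightedColorings Gᶜ := by
  intro a b
  rw [compl_compl]
  induction b generalizing a with
  | zero =>
    intro ha
    refine ⟨0, rfl, by simp, fun x => ?_⟩
    simpa using ha {x} (by simp)
  | succ b ih =>
    intro ha
    obtain ⟨K, hK, hKpos, hKmeet⟩ := hG.exists_clique_meeting a (b + 1) b.succ_pos ha
    obtain ⟨u, hu⟩ : ∃ u : V → ℕ, ∀ x, a x = u x + if x ∈ K then 1 else 0 :=
      ⟨fun x => a x - if x ∈ K then 1 else 0, fun x => by
        by_cases h : x ∈ K
        · have := hKpos x h
          simp only [h, if_true]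
          omega
        · simp [h]⟩
    obtain ⟨s, hcard, hcl, hs⟩ := ih u fun S hS => by
      have h1 : ∑ x ∈ S, a x = ∑ x ∈ S, u x + (K ∩ S).card := by
        simp [hu, Finset.sum_add_distrib, Finset.inter_comm]
      have h2 := ha S hS
      by_cases hSb : ∑ x ∈ S, a x = b + 1
      · have := Finset.card_pos.2 (hKmeet S hS hSb)
        omega
      · omega
    refine ⟨K ::ₘ s, by rw [Multiset.card_cons, hcard], ?_, fun x => ?_⟩
    · intro S hS
      rcases Multiset.mem_cons.1 hS with rfl | hS
      · exact hK
      · exact hcl S hS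
    · rw [Multiset.map_cons, Multiset.sum_cons, ← hs x, hu x, add_comm]

end WeightedColorings

/-- Let `G` be a perfect graph with no isolated vertices,
let `ω_0 = 0` and let `ω_1,…,ω_p` be the incidence vectors of the non-empty
cliques of `G`. Then the monomial subring `K[{x^{ω_i} t : 0 ≤ i ≤ p}]` is
normal: every lattice point `(a,b) ∈ ℤ^{n+1}` of the cone of non-negative
real combinations of `(ω_0,1),(ω_1,1),…,(ω_p,1)` is a non-negative integer
combination of `(ω_0,1),(ω_1,1),…,(ω_p,1)`. (Here the combinations run over
the incidence vectors of all cliques of `G`, including the empty clique.) -/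
theorem clique_subring_normal_of_perfect {n : ℕ} (G : SimpleGraph (Fin n))
    (hiso : ∀ v : Fin n, ∃ w : Fin n, G.Adj v w)
    (hperf : IsPerfect G) :
    ∀ z : (Fin n → ℤ) × ℤ,
      (∃ c : Finset (Fin n) → ℝ, (∀ K, 0 ≤ c K) ∧
        (∀ K, c K ≠ 0 → G.IsClique (K : Set (Fin n))) ∧
        (∀ i, (z.1 i : ℝ) = ∑ K : Finset (Fin n), c K * (if i ∈ K then 1 else 0)) ∧
        (z.2 : ℝ) = ∑ K : Finset (Fin n), c K) →
      ∃ η : Finset (Fin n) → ℕ,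
        (∀ K, η K ≠ 0 → G.IsClique (K : Set (Fin n))) ∧
        (∀ i, z.1 i = ∑ K : Finset (Fin n), (η K : ℤ) * (if i ∈ K then 1 else 0)) ∧
        z.2 = ∑ K : Finset (Fin n), (η K : ℤ) := by
  rintro ⟨z, t⟩ ⟨c, hc, hcl, hz, ht⟩
  simp only at hz ht ⊢
  have hz0 : ∀ i, 0 ≤ z i := by
    intro i
    have h : (0 : ℝ) ≤ z i := by
      rw [hz i]
      exact Finset.sum_nonneg fun K _ => mul_nonneg (hc K) (by split_ifs <;> norm_num)
    exact_mod_cast h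
  have ht0 : 0 ≤ t := by
    have h : (0 : ℝ) ≤ t := by
      rw [ht]
      exact Finset.sum_nonneg fun K _ => hc K
    exact_mod_cast h
  lift z to Fin n → ℕ using hz0
  lift t to ℕ using ht0
  simp only [Int.cast_natCast] at hz ht
  obtain ⟨s, hcard, hs, hsum⟩ := hperf.hasWeightedColorings.compl z t fun S hS => by
    have h : ((∑ x ∈ S, z x : ℕ) : ℝ) ≤ t := by
      push_cast
      simp only [hz, ht]
      rw [Finset.sum_comm]
      refine Finset.sum_le_sum fun K _ => ?_
      rw [← Finset.mul_sum]
      by_cases hK : c K = 0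
      · simp [hK]
      · have h1 : ((S ∩ K).card : ℝ) ≤ 1 := by
          rw [Finset.inter_comm]
          exact_mod_cast card_inter_le_one (hcl K hK) hS
        simpa using mul_le_of_le_one_right (hc K) h1
    exact_mod_cast h
  rw [compl_compl] at hs
  refine ⟨fun K => s.count K, fun K hK => hs K (Multiset.count_ne_zero.1 hK), fun i => ?_, ?_⟩
  · beta_reduce
    rw [hsum i, Finset.sum_multiset_map_count]
    push_cast
    simp only [nsmul_eq_mul]
    push_cast
    refine Finset.sum_subset (Finset.subset_univ _) fun K _ hK => ?_
    rw [Multiset.mem_toFinset] at hK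
    simp [Multiset.count_eq_zero.2 hK]
  · rw [← hcard, ← Multiset.toFinset_sum_count_eq]
    push_cast
    refine Finset.sum_subset (Finset.subset_univ _) fun K _ hK => ?_
    rw [Multiset.mem_toFinset] at hK
    simp [Multiset.count_eq_zero.2 hK]
end
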